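/- Let m ≥ 1 and let S̄ ⊆ (ℤ/mℤ)⁴ be a set of residue classes, and let S be the set of integral binary cubic forms whose coefficient quadruple (a,b,c,d) reduces modulo m into S̄. Assume S is GL₂(ℤ)-invariant under the twisted action. Then for i = 0 (forms of positive discriminant, with n₀ = 6) and i = 1 (forms of negative discriminant, with n₁ = 2), the number N(S ∩ V^{(i)}; X) of GL₂(ℤ)-equivalence classes of irreducible forms in S with discriminant of the appropriate sign and absolute value less than X satisfies lim_{X→∞} N(S ∩ V^{(i)}; X)/X = (π²/(12 n_i)) · (#S̄ / m⁴). -/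

import Mathlib

open Filter Asymptotics Real

/-- An integral binary cubic form `ax³ + bx²y + cxy² + dy³`, recorded as `(a,b,c,d)`. -/
abbrev BinaryCubic := ℤ × ℤ × ℤ × ℤ

/-- The homogeneous polynomial associated to a binary cubic form over a commutative ring. -/
noncomputable def toPoly {A : Type*} [CommRing A] (f : A × A × A × A) :
    MvPolynomial (Fin 2) A :=
  MvPolynomial.C f.1 * MvPolynomial.X 0 ^ 3 +
    MvPolynomial.C f.2.1 * MvPolynomial.X 0 ^ 2 * MvPolynomial.X 1 +
    MvPolynomial.C f.2.2.1 * MvPolynomial.X 0 * MvPolynomial.X 1 ^ 2 +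
    MvPolynomial.C f.2.2.2 * MvPolynomial.X 1 ^ 3

/-- `ActsTo γ f g` means `g = γ · f` under the twisted action
`(γ · f)(x,y) = (det γ)⁻¹ · f((x,y)·γ)`, expressed without inverses as
`(det γ) · (γ·f)(x,y) = f((x,y)·γ)`. -/
def ActsTo {A : Type*} [CommRing A] (γ : Matrix (Fin 2) (Fin 2) A)
    (f g : A × A × A × A) : Prop :=
  MvPolynomial.C γ.det * toPoly g =
    MvPolynomial.bind₁
      (fun j : Fin 2 =>
        MvPolynomial.C (γ 0 j) * MvPolynomial.X 0 + MvPolynomial.C (γ 1 j) * MvPolynomial.X 1)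
      (toPoly f)

/-- `GL₂(ℤ)`-equivalence of integral binary cubic forms (twisted action). -/
def FormEquiv (f g : BinaryCubic) : Prop :=
  ∃ γ : Matrix (Fin 2) (Fin 2) ℤ, IsUnit γ.det ∧ ActsTo γ f g

/-- The discriminant of a binary cubic form `(a,b,c,d)`:
`b²c² − 4ac³ − 4b³d − 27a²d² + 18abcd`. -/
def discF (f : BinaryCubic) : ℤ :=
  f.2.1 ^ 2 * f.2.2.1 ^ 2 - 4 * f.1 * f.2.2.1 ^ 3 - 4 * f.2.1 ^ 3 * f.2.2.2 -
    27 * f.1 ^ 2 * f.2.2.2 ^ 2 + 18 * f.1 * f.2.1 * f.2.2.1 * f.2.2.2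

/-- Irreducibility of a binary cubic form, as a polynomial over `ℚ`. -/
def IrredForm (f : BinaryCubic) : Prop :=
  Irreducible (MvPolynomial.map (Int.castRingHom ℚ) (toPoly f))

/-- The number of `GL₂(ℤ)`-equivalence classes of integral binary cubic forms
satisfying a property `P` (assumed `GL₂(ℤ)`-invariant). -/
noncomputable def countClasses (P : BinaryCubic → Prop) : ℕ :=
  Nat.card (Quot fun f g : { f : BinaryCubic // P f } => FormEquiv f.1 g.1)

/-- Reduction of the coefficients of an integral binary cubic form modulo `m`. -/
def redMod (m : ℕ) (f : BinaryCubic) : ZMod m × ZMod m × ZMod m × ZMod m :=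
  ((f.1 : ZMod m), (f.2.1 : ZMod m), (f.2.2.1 : ZMod m), (f.2.2.2 : ZMod m))

/-- The value at `(x, y)` of the binary cubic form with coefficients `f`. -/
def evalForm {A : Type*} [CommRing A] (f : A × A × A × A) (x y : A) : A :=
  f.1 * x ^ 3 + f.2.1 * x ^ 2 * y + f.2.2.1 * x * y ^ 2 + f.2.2.2 * y ^ 3

lemma eval_toPoly {A : Type*} [CommRing A] (f : A × A × A × A) (v : Fin 2 → A) :
    MvPolynomial.eval v (toPoly f) = evalForm f (v 0) (v 1) := by
  simp [toPoly, evalForm]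

lemma actsTo_iff (γ : Matrix (Fin 2) (Fin 2) ℤ) (f g : BinaryCubic) :
    ActsTo γ f g ↔ ∀ x y : ℤ, γ.det * evalForm g x y =
      evalForm f (x * γ 0 0 + y * γ 1 0) (x * γ 0 1 + y * γ 1 1) := by
  have key : ∀ v : Fin 2 → ℤ, MvPolynomial.eval v (MvPolynomial.bind₁
      (fun j : Fin 2 =>
        MvPolynomial.C (γ 0 j) * MvPolynomial.X 0 + MvPolynomial.C (γ 1 j) * MvPolynomial.X 1)
      (toPoly f)) = evalForm f (v 0 * γ 0 0 + v 1 * γ 1 0) (v 0 * γ 0 1 + v 1 * γ 1 1) := by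
    intro v
    simp [toPoly, evalForm, mul_comm]
  constructor
  · intro h x y
    have := congrArg (MvPolynomial.eval ![x, y]) h
    rw [key, map_mul, eval_toPoly] at this
    simpa using this
  · intro h
    apply MvPolynomial.funext
    intro v
    rw [key, map_mul, eval_toPoly, ← h]
    simp

/-- Coefficients of the form `f((x, y)γ)`. -/
def substForm {A : Type*} [CommRing A] (γ : Matrix (Fin 2) (Fin 2) A) (f : A × A × A × A) :
    A × A × A × A :=
  (f.1 * γ 0 0 ^ 3 + f.2.1 * γ 0 0 ^ 2 * γ 0 1 + f.2.2.1 * γ 0 0 * γ 0 1 ^ 2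
      + f.2.2.2 * γ 0 1 ^ 3,
    3 * f.1 * γ 0 0 ^ 2 * γ 1 0 + f.2.1 * (2 * γ 0 0 * γ 1 0 * γ 0 1 + γ 0 0 ^ 2 * γ 1 1)
      + f.2.2.1 * (γ 1 0 * γ 0 1 ^ 2 + 2 * γ 0 0 * γ 0 1 * γ 1 1)
      + 3 * f.2.2.2 * γ 0 1 ^ 2 * γ 1 1,
    3 * f.1 * γ 0 0 * γ 1 0 ^ 2 + f.2.1 * (2 * γ 0 0 * γ 1 0 * γ 1 1 + γ 1 0 ^ 2 * γ 0 1)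
      + f.2.2.1 * (γ 0 0 * γ 1 1 ^ 2 + 2 * γ 1 0 * γ 0 1 * γ 1 1)
      + 3 * f.2.2.2 * γ 0 1 * γ 1 1 ^ 2,
    f.1 * γ 1 0 ^ 3 + f.2.1 * γ 1 0 ^ 2 * γ 1 1 + f.2.2.1 * γ 1 0 * γ 1 1 ^ 2
      + f.2.2.2 * γ 1 1 ^ 3)

lemma evalForm_substForm {A : Type*} [CommRing A] (γ : Matrix (Fin 2) (Fin 2) A)
    (f : A × A × A × A) (x y : A) :
    evalForm (substForm γ f) x y =
      evalForm f (x * γ 0 0 + y * γ 1 0) (x * γ 0 1 + y * γ 1 1) := by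
  simp only [evalForm, substForm]; ring

lemma evalForm_injective {f g : BinaryCubic}
    (h : ∀ x y : ℤ, evalForm f x y = evalForm g x y) : f = g := by
  obtain ⟨a, b, c, d⟩ := f
  obtain ⟨a', b', c', d'⟩ := g
  have h1 := h 1 0
  have h2 := h 0 1
  have h3 := h 1 1
  have h4 := h 1 (-1)
  simp only [evalForm] at h1 h2 h3 h4
  simp only [Prod.mk.injEq]
  refine ⟨?_, ?_, ?_, ?_⟩ <;> linarith

lemma evalForm_smul {A : Type*} [CommRing A] (t : A) (f : A × A × A × A) (x y : A) :
    evalForm (t • f) x y = t * evalForm f x y := by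
  simp only [evalForm, Prod.smul_fst, Prod.smul_snd, smul_eq_mul]; ring

lemma actsTo_iff_smul (γ : Matrix (Fin 2) (Fin 2) ℤ) (f g : BinaryCubic) :
    ActsTo γ f g ↔ γ.det • g = substForm γ f := by
  rw [actsTo_iff]
  constructor
  · intro h
    apply evalForm_injective
    intro x y
    rw [evalForm_smul, evalForm_substForm, h]
  · intro h x y
    rw [← evalForm_smul, h, evalForm_substForm]

lemma det_mul_self_of_isUnit {γ : Matrix (Fin 2) (Fin 2) ℤ} (h : IsUnit γ.det) :
    γ.det * γ.det = 1 := by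
  rcases Int.isUnit_iff.1 h with h | h <;> rw [h] <;> norm_num

/-- The explicit action of `γ ∈ GL₂(ℤ)`. -/
def actForm (γ : Matrix (Fin 2) (Fin 2) ℤ) (f : BinaryCubic) : BinaryCubic :=
  γ.det • substForm γ f

lemma actsTo_actForm {γ : Matrix (Fin 2) (Fin 2) ℤ} (h : IsUnit γ.det) (f : BinaryCubic) :
    ActsTo γ f (actForm γ f) := by
  rw [actsTo_iff_smul, actForm, smul_smul, det_mul_self_of_isUnit h, one_smul]

lemma formEquiv_refl (f : BinaryCubic) : FormEquiv f f := by
  refine ⟨1, by simp, ?_⟩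
  rw [actsTo_iff]; simp

lemma formEquiv_symm {f g : BinaryCubic} (h : FormEquiv f g) : FormEquiv g f := by
  obtain ⟨γ, hγ, h⟩ := h
  have hd := det_mul_self_of_isUnit hγ
  rw [actsTo_iff] at h
  refine ⟨γ.det • γ.adjugate, ?_, ?_⟩
  · rw [Matrix.det_smul, Matrix.det_adjugate]; simpa using hγ
  · rw [actsTo_iff]
    intro x y
    have hdet : (γ.det • γ.adjugate).det = γ.det := by
      rw [Matrix.det_smul, Matrix.det_adjugate]
      simp only [Fintype.card_fin, pow_two, hd, one_mul, Nat.add_one_sub_one, pow_one]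
    rw [hdet]
    have h1 := h (x * (γ.det • γ.adjugate) 0 0 + y * (γ.det • γ.adjugate) 1 0)
      (x * (γ.det • γ.adjugate) 0 1 + y * (γ.det • γ.adjugate) 1 1)
    have e1 : (x * (γ.det • γ.adjugate) 0 0 + y * (γ.det • γ.adjugate) 1 0) * γ 0 0 +
        (x * (γ.det • γ.adjugate) 0 1 + y * (γ.det • γ.adjugate) 1 1) * γ 1 0 =
        x * (γ.det * γ.det) := by
      simp only [Matrix.adjugate_fin_two, Matrix.det_fin_two, Matrix.smul_apply, Matrix.of_apply,
        Matrix.cons_val', Matrix.cons_val_zero, Matrix.cons_val_one, Matrix.cons_val_fin_one,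
        smul_eq_mul]
      ring
    have e2 : (x * (γ.det • γ.adjugate) 0 0 + y * (γ.det • γ.adjugate) 1 0) * γ 0 1 +
        (x * (γ.det • γ.adjugate) 0 1 + y * (γ.det • γ.adjugate) 1 1) * γ 1 1 =
        y * (γ.det * γ.det) := by
      simp only [Matrix.adjugate_fin_two, Matrix.det_fin_two, Matrix.smul_apply, Matrix.of_apply,
        Matrix.cons_val', Matrix.cons_val_zero, Matrix.cons_val_one, Matrix.cons_val_fin_one,
        smul_eq_mul]
      ring
    rw [e1, e2, hd, mul_one, mul_one] at h1
    rw [← h1, ← mul_assoc, hd, one_mul]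

lemma actsTo_mul {γ γ' : Matrix (Fin 2) (Fin 2) ℤ} {f g k : BinaryCubic} (h : ActsTo γ f g)
    (h' : ActsTo γ' g k) : ActsTo (γ' * γ) f k := by
  rw [actsTo_iff] at h h' ⊢
  intro x y
  rw [Matrix.det_mul, mul_comm γ'.det, mul_assoc, h', h]
  simp only [Matrix.mul_apply, Fin.sum_univ_two]
  congr 1 <;> ring

lemma formEquiv_trans {f g k : BinaryCubic} (h₁ : FormEquiv f g) (h₂ : FormEquiv g k) :
    FormEquiv f k := by
  obtain ⟨γ, hγ, h⟩ := h₁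
  obtain ⟨γ', hγ', h'⟩ := h₂
  exact ⟨γ' * γ, by rw [Matrix.det_mul]; exact hγ'.mul hγ, actsTo_mul h h'⟩

lemma discF_of_formEquiv {f g : BinaryCubic} (h : FormEquiv f g) : discF g = discF f := by
  obtain ⟨γ, hγ, h⟩ := h
  rw [actsTo_iff_smul] at h
  have hd := det_mul_self_of_isUnit hγ
  have h1 : discF (γ.det • g) = discF g := by
    calc discF (γ.det • g) = (γ.det * γ.det) ^ 2 * discF g := by
          simp only [discF, Prod.smul_fst, Prod.smul_snd, smul_eq_mul]; ring
      _ = discF g := by rw [hd]; ring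
  rw [← h1, h]
  calc discF (substForm γ f) = (γ.det * γ.det) ^ 3 * discF f := by
        rw [Matrix.det_fin_two]; simp only [discF, substForm]; ring
    _ = _ := by rw [hd]; ring

lemma exists_int_zero_of_rat_zero {f : BinaryCubic} {x y : ℚ} (hxy : ¬(x = 0 ∧ y = 0))
    (h : evalForm ((f.1 : ℚ), (f.2.1 : ℚ), (f.2.2.1 : ℚ), (f.2.2.2 : ℚ)) x y = 0) :
    ∃ r s : ℤ, ¬(r = 0 ∧ s = 0) ∧ evalForm f r s = 0 := by
  refine ⟨x.num * y.den, y.num * x.den, ?_, ?_⟩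
  · simpa using hxy
  · have hx : (x.num : ℚ) = x * x.den := (Rat.mul_den_eq_num x).symm
    have hy : (y.num : ℚ) = y * y.den := (Rat.mul_den_eq_num y).symm
    have : ((evalForm f (x.num * y.den) (y.num * x.den) : ℤ) : ℚ) =
        (x.den * y.den) ^ 3 *
          evalForm ((f.1 : ℚ), (f.2.1 : ℚ), (f.2.2.1 : ℚ), (f.2.2.2 : ℚ)) x y := by
      simp only [evalForm]
      push_cast
      rw [hx, hy]
      ring
    rw [h, mul_zero] at this
    exact_mod_cast this

lemma evalForm_eq_zero_of_factor {F : ℚ × ℚ × ℚ × ℚ} {P Q : MvPolynomial (Fin 2) ℚ}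
    (hF : toPoly F = P * Q) (hP : P.totalDegree = 1) :
    ∃ x y : ℚ, ¬(x = 0 ∧ y = 0) ∧ evalForm F x y = 0 := by
  obtain ⟨p₀, p₁, p₂, hp⟩ : ∃ p₀ p₁ p₂ : ℚ, P = MvPolynomial.C p₀ +
      (p₁ • MvPolynomial.X 0 + p₂ • MvPolynomial.X 1) := by
    have h1 := MvPolynomial.sum_homogeneousComponent P
    rw [hP, Finset.sum_range_succ, Finset.sum_range_one,
      MvPolynomial.homogeneousComponent_zero] at h1
    have h2 := MvPolynomial.homogeneousComponent_mem 1 P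
    rw [MvPolynomial.homogeneousSubmodule_one_eq_span_X, Submodule.mem_span_range_iff_exists_fun]
      at h2
    obtain ⟨c, hc⟩ := h2
    rw [Fin.sum_univ_two] at hc
    exact ⟨_, c 0, c 1, by rw [hc, h1]⟩
  have hp12 : ¬(p₁ = 0 ∧ p₂ = 0) := by
    rintro ⟨rfl, rfl⟩
    rw [hp] at hP
    simp at hP
  have hpos : p₁ ^ 2 + p₂ ^ 2 ≠ 0 := by
    intro h
    apply hp12
    constructor <;> nlinarith [sq_nonneg p₁, sq_nonneg p₂]
  refine ⟨-p₂, p₁, by simpa [and_comm] using hp12, ?_⟩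
  have hz : ∀ t : ℚ, evalForm F (-p₀ * p₁ / (p₁ ^ 2 + p₂ ^ 2) + t * -p₂)
      (-p₀ * p₂ / (p₁ ^ 2 + p₂ ^ 2) + t * p₁) = 0 := by
    intro t
    have := congrArg (MvPolynomial.eval ![-p₀ * p₁ / (p₁ ^ 2 + p₂ ^ 2) + t * -p₂,
      -p₀ * p₂ / (p₁ ^ 2 + p₂ ^ 2) + t * p₁]) hF
    rw [eval_toPoly, map_mul, hp] at this
    simp only [Matrix.cons_val_zero, Matrix.cons_val_one] at this
    rw [this]
    simp only [map_add, MvPolynomial.eval_C, MvPolynomial.smul_eval, MvPolynomial.eval_X,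
      Matrix.cons_val_zero, Matrix.cons_val_one]
    apply mul_eq_zero_of_left
    field_simp
    ring
  have e0 := hz 0
  have e1 := hz 1
  have e2 := hz 2
  have e3 := hz (-1)
  generalize -p₀ * p₁ / (p₁ ^ 2 + p₂ ^ 2) = X at *
  generalize -p₀ * p₂ / (p₁ ^ 2 + p₂ ^ 2) = Y at *
  simp only [evalForm] at *
  linear_combination (1 / 6) * e2 - (1 / 2) * e1 + (1 / 2) * e0 - (1 / 6) * e3

lemma map_toPoly (f : BinaryCubic) : MvPolynomial.map (Int.castRingHom ℚ) (toPoly f) =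
    toPoly ((f.1 : ℚ), (f.2.1 : ℚ), (f.2.2.1 : ℚ), (f.2.2.2 : ℚ)) := by
  simp [toPoly]

lemma isHomogeneous_toPoly {A : Type*} [CommRing A] (f : A × A × A × A) :
    (toPoly f).IsHomogeneous 3 := by
  have hX : ∀ i : Fin 2, (MvPolynomial.X i : MvPolynomial (Fin 2) A).IsHomogeneous 1 :=
    fun i => MvPolynomial.isHomogeneous_X _ i
  refine (((MvPolynomial.IsHomogeneous.add ?_ ?_).add ?_).add ?_)
  · exact ((hX 0).pow 3).C_mul _
  · exact (((hX 0).pow 2).C_mul _).mul (hX 1)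
  · exact ((hX 0).C_mul _).mul ((hX 1).pow 2)
  · exact ((hX 1).pow 3).C_mul _

lemma not_isUnit_of_eval_eq_zero {P : MvPolynomial (Fin 2) ℚ} (v : Fin 2 → ℚ)
    (h : MvPolynomial.eval v P = 0) : ¬ IsUnit P := by
  intro hP
  have := hP.map (MvPolynomial.eval v)
  rw [h] at this
  exact not_isUnit_zero this

/-- A binary cubic form is irreducible over `ℚ` iff it has no nontrivial integral zero. -/
theorem irredForm_iff (f : BinaryCubic) :
    IrredForm f ↔ ∀ r s : ℤ, evalForm f r s = 0 → r = 0 ∧ s = 0 := by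
  rw [IrredForm, map_toPoly]
  set F : ℚ × ℚ × ℚ × ℚ := ((f.1 : ℚ), (f.2.1 : ℚ), (f.2.2.1 : ℚ), (f.2.2.2 : ℚ)) with hFdef
  constructor
  · intro h r s hrs
    by_contra hne
    obtain ⟨L, Q, hLQ, hL, hQ⟩ : ∃ L Q : MvPolynomial (Fin 2) ℚ, toPoly F = L * Q ∧
        ¬ IsUnit L ∧ ¬ IsUnit Q := by
      have hrsQ : (f.1 : ℚ) * r ^ 3 + f.2.1 * r ^ 2 * s + f.2.2.1 * r * s ^ 2 + f.2.2.2 * s ^ 3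
          = 0 := by
        simp only [evalForm] at hrs
        exact_mod_cast hrs
      by_cases hs : s = 0
      · have hr : r ≠ 0 := fun hr => hne ⟨hr, hs⟩
        subst hs
        have ha : (f.1 : ℚ) = 0 := by
          have : (r : ℚ) ≠ 0 := by exact_mod_cast hr
          simpa [this] using hrsQ
        refine ⟨MvPolynomial.X 1, MvPolynomial.C F.2.1 * MvPolynomial.X 0 ^ 2 +
          MvPolynomial.C F.2.2.1 * MvPolynomial.X 0 * MvPolynomial.X 1 +
          MvPolynomial.C F.2.2.2 * MvPolynomial.X 1 ^ 2, ?_, ?_, ?_⟩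
        · simp only [toPoly, hFdef, ha, map_zero]; ring
        · exact not_isUnit_of_eval_eq_zero 0 (by simp)
        · exact not_isUnit_of_eval_eq_zero 0 (by simp)
      · have hs' : (s : ℚ) ≠ 0 := by exact_mod_cast hs
        refine ⟨MvPolynomial.C (s : ℚ) * MvPolynomial.X 0 - MvPolynomial.C (r : ℚ) *
            MvPolynomial.X 1,
          MvPolynomial.C (f.1 / s : ℚ) * MvPolynomial.X 0 ^ 2 +
          MvPolynomial.C ((f.2.1 + r * (f.1 / s)) / s : ℚ) * MvPolynomial.X 0 *
            MvPolynomial.X 1 +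
          MvPolynomial.C ((f.2.2.1 + r * ((f.2.1 + r * (f.1 / s)) / s)) / s : ℚ) *
            MvPolynomial.X 1 ^ 2, ?_, ?_, ?_⟩
        · apply MvPolynomial.funext
          intro v
          rw [eval_toPoly]
          have hd : (f.2.2.2 : ℚ) = -(f.1 * r ^ 3 + f.2.1 * r ^ 2 * s + f.2.2.1 * r * s ^ 2) /
              s ^ 3 := by
            field_simp
            linarith
          simp only [evalForm, hFdef, hd, map_mul, map_sub, map_add, MvPolynomial.eval_C,
            MvPolynomial.eval_X, map_pow]
          field_simp
          ring
        · exact not_isUnit_of_eval_eq_zero 0 (by simp)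
        · exact not_isUnit_of_eval_eq_zero 0 (by simp)
    rcases h.isUnit_or_isUnit hLQ with h | h
    · exact hL h
    · exact hQ h
  · intro h
    have hF0 : toPoly F ≠ 0 := by
      intro h0
      have := congrArg (MvPolynomial.eval ![1, 0]) h0
      rw [eval_toPoly] at this
      simp only [evalForm, hFdef] at this
      have h1 := h 1 0 (by simp [evalForm]; simpa using this)
      exact one_ne_zero h1.1
    have hdeg := (isHomogeneous_toPoly F).totalDegree hF0
    have nolin : ∀ P Q : MvPolynomial (Fin 2) ℚ, toPoly F = P * Q → P.totalDegree ≠ 1 := by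
      intro P Q hPQ hP
      obtain ⟨x, y, hxy, h0⟩ := evalForm_eq_zero_of_factor hPQ hP
      obtain ⟨r, s, hrs, h1⟩ := exists_int_zero_of_rat_zero hxy h0
      exact hrs (h r s h1)
    have unit_of : ∀ P : MvPolynomial (Fin 2) ℚ, P ≠ 0 → P.totalDegree = 0 → IsUnit P := by
      intro P hP hd
      rw [MvPolynomial.totalDegree_eq_zero_iff_eq_C] at hd
      rw [hd]
      refine (IsUnit.mk0 _ ?_).map MvPolynomial.C
      intro h0
      rw [h0, map_zero] at hd
      exact hP hd
    refine ⟨not_isUnit_of_eval_eq_zero 0 (by rw [eval_toPoly]; simp [evalForm]), ?_⟩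
    intro P Q hPQ
    have hP : P ≠ 0 := by rintro rfl; exact hF0 (by rw [hPQ, zero_mul])
    have hQ : Q ≠ 0 := by rintro rfl; exact hF0 (by rw [hPQ, mul_zero])
    rw [hPQ, MvPolynomial.totalDegree_mul_of_isDomain hP hQ] at hdeg
    have h1 := nolin P Q hPQ
    have h2 := nolin Q P (by rw [hPQ, mul_comm])
    rcases Nat.eq_zero_or_pos P.totalDegree with h0 | h0
    · exact Or.inl (unit_of P hP h0)
    · exact Or.inr (unit_of Q hQ (by omega))

lemma irredForm_of_formEquiv {f g : BinaryCubic} (h : FormEquiv f g) (hf : IrredForm f) :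
    IrredForm g := by
  obtain ⟨γ, hγ, h⟩ := h
  have hd := det_mul_self_of_isUnit hγ
  rw [actsTo_iff] at h
  rw [irredForm_iff] at hf ⊢
  intro r s hrs
  have h1 := h r s
  rw [hrs, mul_zero] at h1
  obtain ⟨h2, h3⟩ := hf _ _ h1.symm
  rw [Matrix.det_fin_two] at hd
  constructor
  · have : r * (γ 0 0 * γ 1 1 - γ 0 1 * γ 1 0) = 0 := by linear_combination γ 1 1 * h2 - γ 1 0 * h3
    have h4 := congrArg (· * (γ 0 0 * γ 1 1 - γ 0 1 * γ 1 0)) this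
    simp only [mul_assoc, hd, zero_mul] at h4
    simpa using h4
  · have : s * (γ 0 0 * γ 1 1 - γ 0 1 * γ 1 0) = 0 := by linear_combination γ 0 0 * h3 - γ 0 1 * h2
    have h4 := congrArg (· * (γ 0 0 * γ 1 1 - γ 0 1 * γ 1 0)) this
    simp only [mul_assoc, hd, zero_mul] at h4
    simpa using h4

lemma IrredForm.fst_ne_zero {f : BinaryCubic} (hf : IrredForm f) : f.1 ≠ 0 := by
  intro h
  rw [irredForm_iff] at hf
  have := hf 1 0 (by simp [evalForm, h])
  exact one_ne_zero this.1

/-- The `x²y`-coefficient of `Re (ω (x + z y)² (x + z' y))`, where `ω = p + q i`, `z = u + v i`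
and `z' = u + e v i`. -/
def cubB (e p q u v : ℝ) : ℝ := 3 * p * u - (2 + e) * q * v

/-- The `xy²`-coefficient of `Re (ω (x + z y)² (x + z' y))`. -/
def cubC (e p q u v : ℝ) : ℝ :=
  p * (3 * u ^ 2 - (1 + 2 * e) * v ^ 2) - q * ((4 + 2 * e) * u * v)

/-- The `y³`-coefficient of `Re (ω (x + z y)² (x + z' y))`. -/
def cubD (e p q u v : ℝ) : ℝ :=
  p * (u ^ 3 - (1 + 2 * e) * u * v ^ 2) - q * ((2 + e) * u ^ 2 * v - e * v ^ 3)

/-- The integral form `f` equals `Re (ω (x + z y)² (x + z' y))`, where `ω = p + q i`,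
`z = u + v i` and `z' = u + e v i`. -/
def HasParam (e p q u v : ℝ) (f : BinaryCubic) : Prop :=
  (f.1 : ℝ) = p ∧ (f.2.1 : ℝ) = cubB e p q u v ∧ (f.2.2.1 : ℝ) = cubC e p q u v ∧
    (f.2.2.2 : ℝ) = cubD e p q u v

lemma evalForm_param (e p q u v x y : ℝ) :
    evalForm (p, cubB e p q u v, cubC e p q u v, cubD e p q u v) x y =
      ((⟨p, q⟩ : ℂ) * (x + (⟨u, v⟩ : ℂ) * y) ^ 2 *
        (x + (⟨u, e * v⟩ : ℂ) * y)).re := by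
  simp [evalForm, cubB, cubC, cubD, pow_two]
  ring

lemma cast_evalForm (f : BinaryCubic) (x y : ℤ) :
    ((evalForm f x y : ℤ) : ℝ) =
      evalForm ((f.1 : ℝ), (f.2.1 : ℝ), (f.2.2.1 : ℝ), (f.2.2.2 : ℝ)) x y := by
  simp [evalForm]

lemma evalForm_real_ext {a b c d a' b' c' d' : ℝ}
    (h : ∀ x y : ℤ, evalForm (a, b, c, d) (x : ℝ) y = evalForm (a', b', c', d') x y) :
    a = a' ∧ b = b' ∧ c = c' ∧ d = d' := by
  have h1 := h 1 0
  have h2 := h 0 1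
  have h3 := h 1 1
  have h4 := h 1 (-1)
  simp only [evalForm] at h1 h2 h3 h4
  push_cast at h1 h2 h3 h4
  refine ⟨?_, ?_, ?_, ?_⟩ <;> linarith

lemma hasParam_iff (e p q u v : ℝ) (f : BinaryCubic) :
    HasParam e p q u v f ↔ ∀ x y : ℤ, ((evalForm f x y : ℤ) : ℝ) =
      ((⟨p, q⟩ : ℂ) * ((x : ℝ) + (⟨u, v⟩ : ℂ) * (y : ℝ)) ^ 2 *
        ((x : ℝ) + (⟨u, e * v⟩ : ℂ) * (y : ℝ))).re := by
  constructor
  · rintro ⟨h1, h2, h3, h4⟩ x y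
    rw [cast_evalForm, h1, h2, h3, h4, evalForm_param]
  · intro h
    apply evalForm_real_ext
    intro x y
    rw [← cast_evalForm, h, evalForm_param]

lemma hasParam_neg {e p q u v : ℝ} {f : BinaryCubic} (h : HasParam e p q u v f) :
    FormEquiv f (-f) ∧ HasParam e (-p) (-q) u v (-f) := by
  constructor
  · refine ⟨-1, by simp [Matrix.det_fin_two], ?_⟩
    rw [actsTo_iff]
    intro x y
    simp [evalForm, Matrix.det_fin_two]
    ring
  · obtain ⟨h1, h2, h3, h4⟩ := h
    refine ⟨?_, ?_, ?_, ?_⟩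
    · simp [h1]
    · simp only [Prod.snd_neg, Prod.fst_neg, Int.cast_neg, h2, cubB]; ring
    · simp only [Prod.snd_neg, Prod.fst_neg, Int.cast_neg, h3, cubC]; ring
    · simp only [Prod.snd_neg, Int.cast_neg, h4, cubD]; ring

/-- The image of a form under the reflection `diag(1, -1)`. -/
def reflectForm (f : BinaryCubic) : BinaryCubic := (-f.1, f.2.1, -f.2.2.1, f.2.2.2)

lemma actsTo_reflectForm (f : BinaryCubic) :
    ActsTo !![1, 0; 0, -1] f (reflectForm f) := by
  rw [actsTo_iff]
  intro x y
  simp [evalForm, Matrix.det_fin_two, reflectForm]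
  ring

lemma formEquiv_reflectForm (f : BinaryCubic) : FormEquiv f (reflectForm f) :=
  ⟨_, by simp [Matrix.det_fin_two], actsTo_reflectForm f⟩

lemma hasParam_reflectForm {e p q u v : ℝ} {f : BinaryCubic} (h : HasParam e p q u v f) :
    HasParam e (-p) q (-u) v (reflectForm f) := by
  obtain ⟨h1, h2, h3, h4⟩ := h
  refine ⟨?_, ?_, ?_, ?_⟩
  · simp [h1, reflectForm]
  · simp only [reflectForm, h2, cubB]; ring
  · simp only [reflectForm, Int.cast_neg, h3, cubC]; ring
  · simp only [reflectForm, h4, cubD]; ring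

/-- The form `f(x + n y, y)`. -/
def translateForm (n : ℤ) (f : BinaryCubic) : BinaryCubic :=
  (f.1, f.2.1 + 3 * f.1 * n, f.2.2.1 + 2 * f.2.1 * n + 3 * f.1 * n ^ 2,
    f.2.2.2 + f.2.2.1 * n + f.2.1 * n ^ 2 + f.1 * n ^ 3)

lemma translateForm_injective (n : ℤ) : Function.Injective (translateForm n) := by
  rintro ⟨a, b, c, d⟩ ⟨a', b', c', d'⟩ h
  simp only [translateForm, Prod.mk.injEq] at h ⊢
  obtain ⟨rfl, h2, h3, h4⟩ := h
  obtain rfl : b = b' := by linarith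
  obtain rfl : c = c' := by linarith
  obtain rfl : d = d' := by linarith
  exact ⟨rfl, rfl, rfl, rfl⟩

lemma hasParam_translateForm {e p q u v : ℝ} {f : BinaryCubic} (h : HasParam e p q u v f)
    (n : ℤ) : HasParam e p q (u + n) v (translateForm n f) := by
  obtain ⟨h1, h2, h3, h4⟩ := h
  refine ⟨?_, ?_, ?_, ?_⟩
  · simp [h1, translateForm]
  · simp only [translateForm]; push_cast; rw [h2, h1]; simp only [cubB]; ring
  · simp only [translateForm]; push_cast; rw [h3, h2, h1]; simp only [cubB, cubC]; ring
  · simp only [translateForm]; push_cast; rw [h4, h3, h2, h1]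
    simp only [cubB, cubC, cubD]; ring

lemma param_injective {e p q u v q' u' v' : ℝ} (he : e = 1 ∨ e = -1) (hp : p ≠ 0)
    (hv : 0 < v) (hv' : 0 < v') (hB : cubB e p q u v = cubB e p q' u' v')
    (hC : cubC e p q u v = cubC e p q' u' v') (hD : cubD e p q u v = cubD e p q' u' v') :
    q = q' ∧ u = u' ∧ v = v' := by
  have hp2 : 0 < p ^ 2 := by positivity
  suffices h : u = u' ∧ v ^ 2 = v' ^ 2 by
    obtain ⟨rfl, h2⟩ := h
    have hvv : v = v' := by
      rw [pow_left_inj₀ hv.le hv'.le two_ne_zero] at h2; exact h2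
    subst hvv
    refine ⟨?_, rfl, rfl⟩
    simp only [cubB] at hB
    have h0 : (2 + e) * v ≠ 0 := by
      rcases he with rfl | rfl <;> norm_num <;> exact hv.ne'
    apply mul_left_cancel₀ h0
    linarith
  rcases he with rfl | rfl
  · have hA : 9 * v ^ 2 * (p ^ 2 + q ^ 2) = 9 * v' ^ 2 * (p ^ 2 + q' ^ 2) := by
      have e1 : cubB 1 p q u v ^ 2 - 3 * p * cubC 1 p q u v = 9 * v ^ 2 * (p ^ 2 + q ^ 2) := by
        simp only [cubB, cubC]; ring
      have e2 : cubB 1 p q' u' v' ^ 2 - 3 * p * cubC 1 p q' u' v' =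
          9 * v' ^ 2 * (p ^ 2 + q' ^ 2) := by
        simp only [cubB, cubC]; ring
      rw [← e1, ← e2, hB, hC]
    have hH1 : 2 * u * (9 * v ^ 2 * (p ^ 2 + q ^ 2)) =
        2 * u' * (9 * v' ^ 2 * (p ^ 2 + q' ^ 2)) := by
      have e1 : cubB 1 p q u v * cubC 1 p q u v - 9 * p * cubD 1 p q u v =
          2 * u * (9 * v ^ 2 * (p ^ 2 + q ^ 2)) := by
        simp only [cubB, cubC, cubD]; ring
      have e2 : cubB 1 p q' u' v' * cubC 1 p q' u' v' - 9 * p * cubD 1 p q' u' v' =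
          2 * u' * (9 * v' ^ 2 * (p ^ 2 + q' ^ 2)) := by
        simp only [cubB, cubC, cubD]; ring
      rw [← e1, ← e2, hB, hC, hD]
    have hH2 : (u ^ 2 + v ^ 2) * (9 * v ^ 2 * (p ^ 2 + q ^ 2)) =
        (u' ^ 2 + v' ^ 2) * (9 * v' ^ 2 * (p ^ 2 + q' ^ 2)) := by
      have e1 : cubC 1 p q u v ^ 2 - 3 * cubB 1 p q u v * cubD 1 p q u v =
          (u ^ 2 + v ^ 2) * (9 * v ^ 2 * (p ^ 2 + q ^ 2)) := by
        simp only [cubB, cubC, cubD]; ring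
      have e2 : cubC 1 p q' u' v' ^ 2 - 3 * cubB 1 p q' u' v' * cubD 1 p q' u' v' =
          (u' ^ 2 + v' ^ 2) * (9 * v' ^ 2 * (p ^ 2 + q' ^ 2)) := by
        simp only [cubB, cubC, cubD]; ring
      rw [← e1, ← e2, hB, hC, hD]
    have hpos : 9 * v' ^ 2 * (p ^ 2 + q' ^ 2) ≠ 0 := by positivity
    rw [hA] at hH1 hH2
    have h1 := mul_right_cancel₀ hpos hH1
    have h2 := mul_right_cancel₀ hpos hH2
    have h3 : u = u' := by linarith
    exact ⟨h3, by rw [h3] at h2; linarith⟩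
  · have hs : p * u - q * v = p * u' - q' * v' := by
      have h0 : p * ((p * u' - q' * v') - (p * u - q * v)) *
          ((p * u' - (p * u - q * v)) ^ 2 + p ^ 2 * v' ^ 2) = 0 := by
        have e1 : evalForm (p, cubB (-1) p q u v, cubC (-1) p q u v, cubD (-1) p q u v)
          (-(p * u - q * v)) p = 0 := by
          simp only [evalForm, cubB, cubC, cubD]; ring
        rw [hB, hC, hD] at e1
        rw [← e1]
        simp only [evalForm, cubB, cubC, cubD]; ring
      have hpos : (p * u' - (p * u - q * v)) ^ 2 + p ^ 2 * v' ^ 2 ≠ 0 := by positivity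
      have h1 := (mul_eq_zero.1 ((mul_eq_zero.1 h0).resolve_right hpos)).resolve_left hp
      linarith
    have hu : u = u' := by
      apply mul_left_cancel₀ hp
      simp only [cubB] at hB
      linarith
    subst hu
    refine ⟨rfl, ?_⟩
    apply mul_left_cancel₀ hp
    have e1 : ∀ q v : ℝ, cubC (-1) p q u v = p * (u ^ 2 + v ^ 2) + 2 * u * (p * u - q * v) := by
      intro q v; simp only [cubC]; ring
    rw [e1, e1, hs] at hC
    linarith

lemma disc_param {e p q u v : ℝ} (he : e = 1 ∨ e = -1) {f : BinaryCubic}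
    (h : HasParam e p q u v f) :
    e * (discF f : ℝ) = (56 + 52 * e) * v ^ 6 * (p ^ 2 + q ^ 2) ^ 2 := by
  obtain ⟨h1, h2, h3, h4⟩ := h
  simp only [discF]
  push_cast
  rw [h1, h2, h3, h4]
  rcases he with rfl | rfl <;> simp only [cubB, cubC, cubD] <;> ring

lemma param_bounds {e p q u v W Z : ℝ} (he : e = 1 ∨ e = -1) (hW : 0 ≤ W) (hZ : 0 ≤ Z)
    (h1 : p ^ 2 + q ^ 2 ≤ W ^ 2) (h2 : u ^ 2 + v ^ 2 ≤ Z ^ 2) :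
    |p| ≤ W ∧ |cubB e p q u v| ≤ 3 * (W * Z) ∧ |cubC e p q u v| ≤ 3 * (W * Z ^ 2) ∧
      |cubD e p q u v| ≤ W * Z ^ 3 := by
  have he2 : e ^ 2 = 1 := by rcases he with rfl | rfl <;> norm_num
  set ω : ℂ := ⟨p, q⟩ with hω
  set z : ℂ := ⟨u, v⟩ with hz
  set z' : ℂ := ⟨u, e * v⟩ with hz'
  have nω : ‖ω‖ ≤ W := by
    rw [Complex.norm_def]
    apply Real.sqrt_le_iff.2 ⟨hW, ?_⟩
    simp only [Complex.normSq_mk, hω]; linarith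
  have nz : ‖z‖ ≤ Z := by
    rw [Complex.norm_def]
    apply Real.sqrt_le_iff.2 ⟨hZ, ?_⟩
    simp only [Complex.normSq_mk, hz]; linarith
  have nz' : ‖z'‖ ≤ Z := by
    rw [Complex.norm_def]
    apply Real.sqrt_le_iff.2 ⟨hZ, ?_⟩
    simp only [Complex.normSq_mk, hz']
    have : e * v * (e * v) = v * v := by linear_combination v ^ 2 * he2
    rw [this]; linarith
  have b1 : ‖2 * z + z'‖ ≤ 3 * Z := by
    calc ‖2 * z + z'‖ ≤ ‖2 * z‖ + ‖z'‖ := norm_add_le _ _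
      _ = 2 * ‖z‖ + ‖z'‖ := by simp
      _ ≤ 3 * Z := by linarith
  have b2 : ‖z * z + 2 * (z * z')‖ ≤ 3 * Z ^ 2 := by
    calc ‖z * z + 2 * (z * z')‖ ≤ ‖z * z‖ + ‖2 * (z * z')‖ := norm_add_le _ _
      _ = ‖z‖ * ‖z‖ + 2 * (‖z‖ * ‖z'‖) := by simp
      _ ≤ Z * Z + 2 * (Z * Z) := by gcongr
      _ = _ := by ring
  have b3 : ‖z * z * z'‖ ≤ Z ^ 3 := by
    calc ‖z * z * z'‖ = ‖z‖ * ‖z‖ * ‖z'‖ := by simp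
      _ ≤ Z * Z * Z := by gcongr
      _ = _ := by ring
  refine ⟨?_, ?_, ?_, ?_⟩
  · calc |p| = |ω.re| := rfl
      _ ≤ ‖ω‖ := Complex.abs_re_le_norm _
      _ ≤ W := nω
  · have : cubB e p q u v = (ω * (2 * z + z')).re := by
      simp [hω, hz, hz', cubB]; ring
    rw [this]
    calc _ ≤ ‖ω * (2 * z + z')‖ := Complex.abs_re_le_norm _
      _ = ‖ω‖ * ‖2 * z + z'‖ := norm_mul _ _
      _ ≤ W * (3 * Z) := by gcongr
      _ = _ := by ring
  · have : cubC e p q u v = (ω * (z * z + 2 * (z * z'))).re := by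
      simp [hω, hz, hz', cubC]; ring
    rw [this]
    calc _ ≤ ‖ω * (z * z + 2 * (z * z'))‖ := Complex.abs_re_le_norm _
      _ = ‖ω‖ * ‖z * z + 2 * (z * z')‖ := norm_mul _ _
      _ ≤ W * (3 * Z ^ 2) := by gcongr
      _ = _ := by ring
  · have : cubD e p q u v = (ω * (z * z * z')).re := by
      simp [hω, hz, hz', cubD]; ring
    rw [this]
    calc _ ≤ ‖ω * (z * z * z')‖ := Complex.abs_re_le_norm _
      _ = ‖ω‖ * ‖z * z * z'‖ := norm_mul _ _
      _ ≤ _ := by gcongr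

lemma exists_param_pos {f : BinaryCubic} (ha : f.1 ≠ 0) (hd : 0 < discF f) :
    ∃ p q u v : ℝ, 0 < v ∧ HasParam 1 p q u v f := by
  obtain ⟨a, b, c, d⟩ := f
  have ha : (a : ℝ) ≠ 0 := by exact_mod_cast ha
  have hd : (0 : ℝ) < discF (a, b, c, d) := by exact_mod_cast hd
  simp only [discF] at hd
  push_cast at hd
  simp only [HasParam]
  generalize (a : ℝ) = a at *
  generalize (b : ℝ) = b at *
  generalize (c : ℝ) = c at *
  generalize (d : ℝ) = d at *
  set D := b ^ 2 * c ^ 2 - 4 * a * c ^ 3 - 4 * b ^ 3 * d - 27 * a ^ 2 * d ^ 2 + 18 * a * b * c * d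
    with hD
  have hA : 0 < b ^ 2 - 3 * a * c := by
    have h1 : 4 * (b ^ 2 - 3 * a * c) ^ 3 =
        27 * a ^ 2 * D + (2 * b ^ 3 - 9 * a * b * c + 27 * a ^ 2 * d) ^ 2 := by
      rw [hD]; ring
    have h2 : 0 < 27 * a ^ 2 * D := by positivity
    by_contra hneg
    have h3 : (b ^ 2 - 3 * a * c) ^ 3 ≤ 0 := by
      have : 0 ≤ (-(b ^ 2 - 3 * a * c)) ^ 3 := pow_nonneg (by linarith) 3
      nlinarith
    nlinarith [sq_nonneg (2 * b ^ 3 - 9 * a * b * c + 27 * a ^ 2 * d)]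
  set A := b ^ 2 - 3 * a * c with hAdef
  set u := (b * c - 9 * a * d) / (2 * A) with hu
  set v := √(3 * D) / (2 * A) with hv
  have hv0 : 0 < v := by positivity
  have huA : 2 * A * u = b * c - 9 * a * d := by rw [hu]; field_simp
  have huv : A * (u ^ 2 + v ^ 2) = c ^ 2 - 3 * b * d := by
    have hv2 : v ^ 2 = 3 * D / (4 * A ^ 2) := by
      rw [hv, div_pow, Real.sq_sqrt (by positivity)]; ring
    rw [hv2, hu]
    field_simp
    rw [hD, hAdef]; ring
  refine ⟨a, (3 * a * u - b) / (3 * v), u, v, hv0, rfl, ?_, ?_, ?_⟩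
  · simp only [cubB]; field_simp; ring
  · have : cubC 1 a ((3 * a * u - b) / (3 * v)) u v = -3 * a * (u ^ 2 + v ^ 2) + 2 * u * b := by
      simp only [cubC]; field_simp; ring
    rw [this]
    apply mul_left_cancel₀ hA.ne'
    linear_combination (-b) * huA + 3 * a * huv
  · have : cubD 1 a ((3 * a * u - b) / (3 * v)) u v =
        -2 * a * u * (u ^ 2 + v ^ 2) + (b / 3) * (4 * u ^ 2 - (u ^ 2 + v ^ 2)) := by
      simp only [cubD]; field_simp; ring
    rw [this]
    have h3 : A * A * d = A * A * (-2 * a * u * (u ^ 2 + v ^ 2) +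
        (b / 3) * (4 * u ^ 2 - (u ^ 2 + v ^ 2))) := by
      have : A * A * (-2 * a * u * (u ^ 2 + v ^ 2) +
        (b / 3) * (4 * u ^ 2 - (u ^ 2 + v ^ 2))) = -a * (2 * A * u) * (A * (u ^ 2 + v ^ 2)) +
          (b / 3) * ((2 * A * u) ^ 2 - A * (A * (u ^ 2 + v ^ 2))) := by ring
      rw [this, huA, huv, hAdef]; ring
    exact mul_left_cancel₀ (mul_ne_zero hA.ne' hA.ne') h3

lemma exists_cubic_root {a b c d : ℝ} (ha : a ≠ 0) :
    ∃ t : ℝ, a * t ^ 3 + b * t ^ 2 + c * t + d = 0 := by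
  wlog hpos : 0 < a generalizing a b c d
  · obtain ⟨t, ht⟩ := this (a := -a) (b := -b) (c := -c) (d := -d) (neg_ne_zero.2 ha)
      (by have := lt_of_le_of_ne (not_lt.1 hpos) ha; linarith)
    exact ⟨t, by linarith⟩
  set M := (|b| + |c| + |d|) / a + 1 with hM
  have hM1 : 1 ≤ M := by
    have : 0 ≤ (|b| + |c| + |d|) / a := by positivity
    linarith
  have hMa : |b| + |c| + |d| ≤ a * M := by
    have : a * M = |b| + |c| + |d| + a := by rw [hM]; field_simp
    linarith
  have hM2 : M ≤ M ^ 2 := by nlinarith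
  have hkey : |b| * M ^ 2 + |c| * M + |d| ≤ a * M ^ 3 := by
    have h1 : |c| * M ≤ |c| * M ^ 2 := by gcongr
    have h2 : |d| ≤ |d| * M ^ 2 := le_mul_of_one_le_right (abs_nonneg _) (by linarith)
    have h3 : (|b| + |c| + |d|) * M ^ 2 ≤ a * M * M ^ 2 := by gcongr
    nlinarith
  have hcont : Continuous fun t : ℝ => a * t ^ 3 + b * t ^ 2 + c * t + d := by fun_prop
  have hM0 : 0 ≤ M := by linarith
  have hlo : a * (-M) ^ 3 + b * (-M) ^ 2 + c * (-M) + d ≤ 0 := by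
    have h1 : b * M ^ 2 ≤ |b| * M ^ 2 := by gcongr; exact le_abs_self b
    have h2 : -c * M ≤ |c| * M := by gcongr; exact neg_le_abs c
    have h3 := le_abs_self d
    nlinarith
  have hhi : 0 ≤ a * M ^ 3 + b * M ^ 2 + c * M + d := by
    have h1 : -b * M ^ 2 ≤ |b| * M ^ 2 := by gcongr; exact neg_le_abs b
    have h2 : -c * M ≤ |c| * M := by gcongr; exact neg_le_abs c
    have h3 := neg_le_abs d
    nlinarith
  obtain ⟨t, -, ht⟩ := intermediate_value_Icc (by linarith : -M ≤ M) hcont.continuousOn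
    (show (0 : ℝ) ∈ Set.Icc _ _ from ⟨hlo, hhi⟩)
  exact ⟨t, ht⟩

lemma exists_param_neg {f : BinaryCubic} (ha : f.1 ≠ 0) (hd : discF f < 0) :
    ∃ p q u v : ℝ, 0 < v ∧ HasParam (-1) p q u v f := by
  obtain ⟨a, b, c, d⟩ := f
  have ha : (a : ℝ) ≠ 0 := by exact_mod_cast ha
  have hd : (discF (a, b, c, d) : ℝ) < 0 := by exact_mod_cast hd
  simp only [discF] at hd
  push_cast at hd
  simp only [HasParam]
  generalize (a : ℝ) = a at *
  generalize (b : ℝ) = b at *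
  generalize (c : ℝ) = c at *
  generalize (d : ℝ) = d at *
  obtain ⟨t, ht⟩ := exists_cubic_root (a := a) (b := b) (c := c) (d := d) ha
  set s := -a * t with hs
  set u := (b - s) / (2 * a) with hu
  set w := (c - 2 * u * s) / a with hw
  have hb : b = 2 * u * a + s := by rw [hu]; field_simp; ring
  have hc : c = w * a + 2 * u * s := by rw [hw]; field_simp; ring
  have hds : d = s * w := by
    have : d = -(a * t ^ 3 + b * t ^ 2 + c * t) := by linarith
    rw [this, hc, hb, hs]; ring
  have hv : 0 < w - u ^ 2 := by
    rw [hds, hc, hb] at hd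
    have h1 : (4 * u ^ 2 - 4 * w) * (s ^ 2 - 2 * u * s * a + w * a ^ 2) ^ 2 < 0 := by
      convert hd using 1; ring
    by_contra hneg
    have : 0 ≤ (4 * u ^ 2 - 4 * w) * (s ^ 2 - 2 * u * s * a + w * a ^ 2) ^ 2 :=
      mul_nonneg (by linarith) (sq_nonneg _)
    linarith
  set v := √(w - u ^ 2) with hvdef
  have hv0 : 0 < v := Real.sqrt_pos.2 hv
  have hv2 : v ^ 2 = w - u ^ 2 := Real.sq_sqrt hv.le
  refine ⟨a, (a * u - s) / v, u, v, hv0, rfl, ?_, ?_, ?_⟩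
  · simp only [cubB]; rw [hb]; field_simp; ring
  · have : cubC (-1) a ((a * u - s) / v) u v = a * (u ^ 2 + v ^ 2) + 2 * u * s := by
      simp only [cubC]; field_simp; ring
    rw [this, hv2, hc]; ring
  · have : cubD (-1) a ((a * u - s) / v) u v = s * (u ^ 2 + v ^ 2) := by
      simp only [cubD]; field_simp; ring
    rw [this, hv2, hds]; ring

lemma exists_param {e : ℝ} (he : e = 1 ∨ e = -1) {f : BinaryCubic} (ha : f.1 ≠ 0)
    (hd : 0 < e * (discF f : ℝ)) : ∃ p q u v : ℝ, 0 < v ∧ HasParam e p q u v f := by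
  rcases he with rfl | rfl
  · exact exists_param_pos ha (by rw [one_mul] at hd; exact_mod_cast hd)
  · refine exists_param_neg ha ?_
    have : (discF f : ℝ) < 0 := by linarith
    exact_mod_cast this

lemma hasParam_of_det_one {e p q u v : ℝ} (he : e = 1 ∨ e = -1) {f g : BinaryCubic}
    {γ : Matrix (Fin 2) (Fin 2) ℤ} (hγ : γ.det = 1) (h : ActsTo γ f g) (hv : 0 < v)
    (hf : HasParam e p q u v f) :
    ∃ p' q' u' v' : ℝ, HasParam e p' q' u' v' g ∧ 0 < v' ∧
      (⟨u', v'⟩ : ℂ) * (γ 0 0 + γ 0 1 * (⟨u, v⟩ : ℂ)) = γ 1 0 + γ 1 1 * (⟨u, v⟩ : ℂ) := by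
  have hdet := hγ
  rw [Matrix.det_fin_two] at hdet
  have hdetR : (γ 0 0 : ℝ) * γ 1 1 - γ 0 1 * γ 1 0 = 1 := by exact_mod_cast hdet
  set z : ℂ := ⟨u, v⟩ with hz
  set j : ℂ := γ 0 0 + γ 0 1 * z with hj
  have hj0 : j ≠ 0 := by
    intro h0
    have him := congrArg Complex.im h0
    have hre := congrArg Complex.re h0
    simp [hj, hz] at him hre
    have h01 : γ 0 1 = 0 := by rcases him with h | h; exacts [h, absurd h hv.ne']
    rw [h01] at hre hdet
    simp at hre
    rw [hre] at hdet
    simp at hdet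
  set z' : ℂ := (γ 1 0 + γ 1 1 * z) / j with hz'
  have hzj : z' * j = γ 1 0 + γ 1 1 * z := div_mul_cancel₀ _ hj0
  have him : z'.im = v / Complex.normSq j := by
    rw [hz', Complex.div_im, ← sub_div]
    congr 1
    simp [hj, hz]
    linear_combination v * hdetR
  have hv' : 0 < z'.im := by
    rw [him]; exact div_pos hv (Complex.normSq_pos.2 hj0)
  obtain ⟨j', hjj⟩ : ∃ j' : ℂ, j' = γ 0 0 + γ 0 1 * (⟨u, e * v⟩ : ℂ) := ⟨_, rfl⟩
  have hzj' : (⟨z'.re, e * z'.im⟩ : ℂ) * j' = γ 1 0 + γ 1 1 * (⟨u, e * v⟩ : ℂ) := by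
    rcases he with rfl | rfl
    · simpa [hjj] using hzj
    · have := congrArg (starRingEnd ℂ) hzj
      have e1 : (⟨u, -1 * v⟩ : ℂ) = starRingEnd ℂ z := by
        apply Complex.ext <;> simp [hz]
      have e2 : (⟨z'.re, -1 * z'.im⟩ : ℂ) = starRingEnd ℂ z' := by
        apply Complex.ext <;> simp
      have e3 : j' = starRingEnd ℂ j := by
        rw [hjj, hj, e1]; simp
      rw [e1, e2, e3]
      simpa using this
  refine ⟨((⟨p, q⟩ : ℂ) * j ^ 2 * j').re, ((⟨p, q⟩ : ℂ) * j ^ 2 * j').im, z'.re, z'.im, ?_, hv',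
    by simpa using hzj⟩
  rw [hasParam_iff] at hf ⊢
  intro x y
  rw [actsTo_iff] at h
  have h1 := h x y
  rw [hγ, one_mul] at h1
  rw [h1, hf]
  congr 1
  rw [Complex.eta, Complex.eta]
  have e1 : (((x * γ 0 0 + y * γ 1 0 : ℤ) : ℝ) : ℂ) + z * ((x * γ 0 1 + y * γ 1 1 : ℤ) : ℝ) =
      j * ((x : ℝ) + z' * (y : ℝ)) := by
    push_cast
    linear_combination (-(y : ℂ)) * hzj + (-(x : ℂ)) * hj
  have e2 : (((x * γ 0 0 + y * γ 1 0 : ℤ) : ℝ) : ℂ) +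
      (⟨u, e * v⟩ : ℂ) * ((x * γ 0 1 + y * γ 1 1 : ℤ) : ℝ) =
      j' * ((x : ℝ) + (⟨z'.re, e * z'.im⟩ : ℂ) * (y : ℝ)) := by
    push_cast
    linear_combination (-(y : ℂ)) * hzj' + (-(x : ℂ)) * hjj
  rw [e1, e2]
  ring

/-- Every irreducible form is equivalent to one whose covariant point lies in the closed
fundamental domain for `GL₂(ℤ)` and whose leading coefficient is positive. -/
lemma exists_reduced {e : ℝ} (he : e = 1 ∨ e = -1) {f : BinaryCubic} (hf : IrredForm f)
    (hd : 0 < e * (discF f : ℝ)) :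
    ∃ g : BinaryCubic, FormEquiv f g ∧ ∃ p q u v : ℝ, HasParam e p q u v g ∧ 0 < p ∧
      0 < v ∧ 0 ≤ u ∧ u ≤ 1 / 2 ∧ 1 ≤ u ^ 2 + v ^ 2 := by
  obtain ⟨p, q, u, v, hv, h⟩ := exists_param he hf.fst_ne_zero hd
  obtain ⟨M, hM⟩ := ModularGroup.exists_smul_mem_fd (UpperHalfPlane.mk ⟨u, v⟩ hv)
  have hM1 : M 0 0 * M 1 1 - M 0 1 * M 1 0 = 1 := by
    rw [← Matrix.det_fin_two]; exact M.2
  have hdet : (!![M 1 1, M 1 0; M 0 1, M 0 0] : Matrix (Fin 2) (Fin 2) ℤ).det = 1 := by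
    rw [Matrix.det_fin_two]
    simp
    linarith
  set γ : Matrix (Fin 2) (Fin 2) ℤ := !![M 1 1, M 1 0; M 0 1, M 0 0] with hγ
  have hact := actsTo_actForm (γ := γ) (by rw [hdet]; exact isUnit_one) f
  have heq : FormEquiv f (actForm γ f) := ⟨γ, by rw [hdet]; exact isUnit_one, hact⟩
  obtain ⟨p', q', u', v', hg, hv', hz⟩ := hasParam_of_det_one he hdet hact hv h
  have hfd : 1 ≤ u' ^ 2 + v' ^ 2 ∧ |u'| ≤ 1 / 2 := by
    have hzz : ((M • (UpperHalfPlane.mk ⟨u, v⟩ hv) : UpperHalfPlane) : ℂ) = ⟨u', v'⟩ := by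
      rw [UpperHalfPlane.coe_specialLinearGroup_apply, div_eq_iff]
      · simp [hγ] at hz ⊢
        rw [add_comm ((M 1 0 : ℂ) * _), hz]; ring
      · have := UpperHalfPlane.denom_ne_zero (M : GL (Fin 2) ℝ) (UpperHalfPlane.mk ⟨u, v⟩ hv)
        simpa [UpperHalfPlane.denom] using this
    have h1 := hM.1
    have h2 := hM.2
    rw [← UpperHalfPlane.coe_re, hzz] at h2
    rw [hzz, Complex.normSq_mk] at h1
    exact ⟨by linarith, h2⟩
  obtain ⟨k, hk, p₂, q₂, u₂, hk2, hu0, hu1, hu2⟩ : ∃ k : BinaryCubic, FormEquiv f k ∧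
      ∃ p₂ q₂ u₂ : ℝ, HasParam e p₂ q₂ u₂ v' k ∧ 0 ≤ u₂ ∧ u₂ ≤ 1 / 2 ∧ 1 ≤ u₂ ^ 2 + v' ^ 2 := by
    obtain ⟨h3, h4⟩ := abs_le.1 hfd.2
    rcases le_total 0 u' with h0 | h0
    · exact ⟨_, heq, p', q', u', hg, h0, h4, hfd.1⟩
    · refine ⟨_, formEquiv_trans heq (formEquiv_reflectForm _), _, _, _,
        hasParam_reflectForm hg, by linarith, by linarith, ?_⟩
      rw [neg_sq]; exact hfd.1
  have hp₂ : p₂ ≠ 0 := by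
    have h1 := (irredForm_of_formEquiv hk hf).fst_ne_zero
    rw [← hk2.1]; exact_mod_cast h1
  rcases lt_or_gt_of_ne hp₂ with h0 | h0
  · obtain ⟨h1, h2⟩ := hasParam_neg hk2
    exact ⟨-k, formEquiv_trans hk h1, _, _, _, _, h2, by linarith, hv', hu0, hu1, hu2⟩
  · exact ⟨k, hk, _, _, _, _, hk2, h0, hv', hu0, hu1, hu2⟩

lemma one_lt_norm_form {s t : ℤ} {u v : ℝ} (ht : t ≠ 0) (hu : |u| ≤ 1 / 2)
    (h : 1 < u ^ 2 + v ^ 2) : 1 < (s + t * u) ^ 2 + (t * v) ^ 2 := by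
  have h1 : (1 : ℝ) ≤ s ^ 2 - |(s : ℝ)| * |(t : ℝ)| + t ^ 2 := by
    have h2 : (1 : ℤ) ≤ |s| ^ 2 - |s| * |t| + |t| ^ 2 := by
      have : 1 ≤ |t| := Int.one_le_abs ht
      nlinarith [abs_nonneg s, sq_nonneg (|s| - |t|), sq_nonneg (2 * |s| - |t|)]
    have h3 : (1 : ℝ) ≤ |(s : ℝ)| ^ 2 - |(s : ℝ)| * |(t : ℝ)| + |(t : ℝ)| ^ 2 := by
      exact_mod_cast h2
    rwa [sq_abs, sq_abs] at h3
  have h4 : (0 : ℝ) < t ^ 2 := by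
    have : (t : ℝ) ≠ 0 := by exact_mod_cast ht
    positivity
  have h5 : -(|(s : ℝ)| * |(t : ℝ)|) ≤ 2 * (s * t * u) := by
    have : |2 * (s * t * u)| ≤ |(s : ℝ)| * |(t : ℝ)| := by
      rw [abs_mul, abs_mul, abs_mul, abs_two]
      have : 0 ≤ |(s : ℝ)| * |(t : ℝ)| := by positivity
      nlinarith
    linarith [neg_abs_le (2 * (s * t * u))]
  nlinarith

lemma translation_of_reduced {u v u' v' : ℝ} {γ : Matrix (Fin 2) (Fin 2) ℤ} (hγ : γ.det = 1)
    (hz : (⟨u', v'⟩ : ℂ) * (γ 0 0 + γ 0 1 * (⟨u, v⟩ : ℂ)) = γ 1 0 + γ 1 1 * (⟨u, v⟩ : ℂ))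
    (hu : |u| ≤ 1 / 2) (hu' : |u'| ≤ 1 / 2) (h : 1 < u ^ 2 + v ^ 2)
    (h' : 1 < u' ^ 2 + v' ^ 2) :
    ∃ s n : ℤ, s * s = 1 ∧ u' = u + n ∧ γ 0 0 = s ∧ γ 0 1 = 0 ∧ γ 1 0 = s * n ∧ γ 1 1 = s := by
  rw [Matrix.det_fin_two] at hγ
  have hre := congrArg Complex.re hz
  have him := congrArg Complex.im hz
  simp at hre him
  have h01 : γ 0 1 = 0 := by
    by_contra hne
    have hN := one_lt_norm_form (s := γ 0 0) hne hu h
    have hN' := one_lt_norm_form (s := γ 1 1) (neg_ne_zero.2 hne) hu' h'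
    push_cast at hN'
    have hdet : (γ 0 0 : ℝ) * γ 1 1 - γ 0 1 * γ 1 0 = 1 := by exact_mod_cast hγ
    have r1 : (γ 0 0 + γ 0 1 * u) * (γ 1 1 + -γ 0 1 * u') - (γ 0 1 * v) * (-γ 0 1 * v') = 1 := by
      linear_combination hdet - γ 0 1 * hre
    have r2 : (γ 0 0 + γ 0 1 * u) * (-γ 0 1 * v') + (γ 0 1 * v) * (γ 1 1 + -γ 0 1 * u') = 0 := by
      linear_combination -γ 0 1 * him
    have : ((γ 0 0 + γ 0 1 * u) ^ 2 + (γ 0 1 * v) ^ 2) *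
        ((γ 1 1 + -γ 0 1 * u') ^ 2 + (-γ 0 1 * v') ^ 2) = 1 := by
      calc _ = ((γ 0 0 + γ 0 1 * u) * (γ 1 1 + -γ 0 1 * u') - (γ 0 1 * v) * (-γ 0 1 * v')) ^ 2 +
          ((γ 0 0 + γ 0 1 * u) * (-γ 0 1 * v') + (γ 0 1 * v) * (γ 1 1 + -γ 0 1 * u')) ^ 2 := by
            ring
        _ = 1 := by rw [r1, r2]; norm_num
    nlinarith
  rw [h01] at hγ hre him
  have hs : γ 0 0 = γ 1 1 ∧ γ 0 0 * γ 0 0 = 1 := by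
    have h1 : γ 0 0 * γ 1 1 = 1 := by linarith
    rcases Int.eq_one_or_neg_one_of_mul_eq_one' h1 with ⟨h2, h3⟩ | ⟨h2, h3⟩ <;> simp [h2, h3]
  refine ⟨γ 0 0, γ 0 0 * γ 1 0, hs.2, ?_, rfl, h01, ?_, hs.1.symm⟩
  · have h2 : (γ 0 0 : ℝ) * γ 0 0 = 1 := by exact_mod_cast hs.2
    rw [← hs.1] at hre
    push_cast
    simp at hre
    linear_combination (γ 0 0 : ℝ) * hre + (u - u') * h2
  · rw [← mul_assoc, hs.2, one_mul]

/-- Two equivalent strictly reduced forms with positive leading coefficient are equal. -/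
lemma eq_of_reduced {e p q u v p' q' u' v' : ℝ} (he : e = 1 ∨ e = -1) {f g : BinaryCubic}
    (h : FormEquiv f g) (hf : HasParam e p q u v f) (hg : HasParam e p' q' u' v' g)
    (hp : 0 < p) (hp' : 0 < p') (hv : 0 < v) (hv' : 0 < v')
    (hu0 : 0 < u) (hu1 : u < 1 / 2) (hu0' : 0 < u') (hu1' : u' < 1 / 2)
    (hz : 1 < u ^ 2 + v ^ 2) (hz' : 1 < u' ^ 2 + v' ^ 2) : f = g := by
  have hau : |u| ≤ 1 / 2 := by rw [abs_of_pos hu0]; linarith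
  have hau' : |u'| ≤ 1 / 2 := by rw [abs_of_pos hu0']; linarith
  have unique : ∀ {P Q U V P' Q' U' V' : ℝ} {k : BinaryCubic}, HasParam e P Q U V k →
      HasParam e P' Q' U' V' k → P ≠ 0 → 0 < V → 0 < V' → U = U' ∧ V = V' := by
    intro P Q U V P' Q' U' V' k h1 h2 hP hV hV'
    have hPP : P = P' := by rw [← h1.1, ← h2.1]
    subst hPP
    exact (param_injective he hP hV hV' (by rw [← h1.2.1, ← h2.2.1])
      (by rw [← h1.2.2.1, ← h2.2.2.1]) (by rw [← h1.2.2.2, ← h2.2.2.2])).2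
  obtain ⟨γ, hγ, hact⟩ := h
  rcases Int.isUnit_iff.1 hγ with hdet | hdet
  · obtain ⟨P, Q, U, V, hP, hV, hj⟩ := hasParam_of_det_one he hdet hact hv hf
    obtain ⟨rfl, rfl⟩ := unique hg hP hp'.ne' hv' hV
    obtain ⟨s, n, hs, hn, h00, h01, h10, h11⟩ := translation_of_reduced hdet hj hau hau' hz hz'
    have hn0 : n = 0 := by
      have h1 : (n : ℝ) < 1 := by linarith
      have h2 : (-1 : ℝ) < n := by linarith
      have h3 : n < 1 := by exact_mod_cast h1
      have h4 : -1 < n := by exact_mod_cast h2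
      omega
    rw [actsTo_iff_smul, hdet, one_smul] at hact
    have hgf : g = s • f := by
      rw [hact]
      have h3 : s ^ 3 = s := by rw [pow_succ, pow_two, hs, one_mul]
      simp only [substForm, h00, h01, h10, h11, hn0]
      ext <;> simp <;> linear_combination (by assumption : s ^ 3 = s) * _
    rcases Int.isUnit_iff.1 (IsUnit.of_mul_eq_one s hs) with rfl | rfl
    · rw [hgf, one_smul]
    · exfalso
      have h1 := hg.1
      rw [hgf] at h1
      have h2 := hf.1
      simp at h1
      linarith
  · exfalso
    have hact' := actsTo_mul hact (actsTo_reflectForm g)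
    have hdet' : (!![1, 0; 0, -1] * γ : Matrix (Fin 2) (Fin 2) ℤ).det = 1 := by
      rw [Matrix.det_mul, hdet]; simp [Matrix.det_fin_two]
    obtain ⟨P, Q, U, V, hP, hV, hj⟩ := hasParam_of_det_one he hdet' hact' hv hf
    obtain ⟨rfl, rfl⟩ := unique (hasParam_reflectForm hg) hP (by simpa using hp'.ne') hv' hV
    obtain ⟨s, n, hs, hn, -⟩ := translation_of_reduced hdet' hj hau (by rwa [abs_neg]) hz
      (by rwa [neg_sq])
    have h1 : (n : ℝ) < 0 := by linarith
    have h2 : (-1 : ℝ) < n := by linarith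
    have h3 : n < 0 := by exact_mod_cast h1
    have h4 : -1 < n := by exact_mod_cast h2
    omega

/-- The point `c + m k` of a translated lattice, scaled by `1 / t`. -/
noncomputable def latticePoint {ι : Type*} (c : ι → ℤ) (m : ℕ) (t : ℝ) (k : ι → ℤ) : ι → ℝ :=
  fun i => ((c i : ℝ) + m * k i) / t

lemma abs_latticePoint_floor_sub_le {ι : Type*} (c : ι → ℤ) {m : ℕ} (hm : 1 ≤ m) {t : ℝ}
    (ht : 0 < t) (x : ι → ℝ) (i : ι) :
    |latticePoint c m t (fun i => ⌊t * x i / m⌋) i - x i| ≤ (|(c i : ℝ)| + m) * t⁻¹ := by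
  have hm' : (0 : ℝ) < m := by exact_mod_cast hm
  have h1 := Int.floor_le (t * x i / m)
  have h2 := (Int.lt_floor_add_one (t * x i / m)).le
  rw [le_div_iff₀ hm'] at h1
  rw [div_le_iff₀ hm'] at h2
  simp only [latticePoint]
  have : ((c i : ℝ) + m * ⌊t * x i / m⌋) / t - x i =
      (c i + (m * ⌊t * x i / m⌋ - t * x i)) * t⁻¹ := by
    field_simp
    ring
  rw [this, abs_mul, abs_of_pos (inv_pos.2 ht)]
  gcongr
  refine (abs_add_le _ _).trans ?_
  gcongr
  rw [abs_le]
  constructor <;> nlinarith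

lemma tendsto_latticePoint_floor {ι : Type*} (c : ι → ℤ) {m : ℕ} (hm : 1 ≤ m) (x : ι → ℝ) :
    Tendsto (fun t : ℝ => latticePoint c m t (fun i => ⌊t * x i / m⌋)) atTop (nhds x) := by
  rw [tendsto_pi_nhds]
  intro i
  rw [tendsto_iff_norm_sub_tendsto_zero]
  have h : Tendsto (fun t : ℝ => (|(c i : ℝ)| + m) * t⁻¹) atTop (nhds 0) := by
    simpa using tendsto_inv_atTop_zero.const_mul (|(c i : ℝ)| + m)
  refine squeeze_zero' (Eventually.of_forall fun _ => norm_nonneg _) ?_ h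
  filter_upwards [eventually_gt_atTop 0] with t ht
  exact abs_latticePoint_floor_sub_le c hm ht x i

lemma finite_latticePoint_mem {ι : Type*} [Fintype ι] {s : Set (ι → ℝ)}
    (hb : Bornology.IsBounded s) (c : ι → ℤ) {m : ℕ} (hm : 1 ≤ m) {t : ℝ} (ht : 0 < t) :
    {k : ι → ℤ | latticePoint c m t k ∈ s}.Finite := by
  classical
  have hm' : (1 : ℝ) ≤ m := by exact_mod_cast hm
  obtain ⟨r, hr⟩ := hb.subset_closedBall 0
  refine (Set.finite_Icc (fun i => -⌈r * t + |(c i : ℝ)|⌉)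
    (fun i => ⌈r * t + |(c i : ℝ)|⌉)).subset ?_
  intro k hk
  have hk' := hr hk
  rw [mem_closedBall_zero_iff] at hk'
  have key : ∀ i, |(k i : ℝ)| ≤ r * t + |(c i : ℝ)| := by
    intro i
    have h1 := (norm_le_pi_norm _ i).trans hk'
    simp only [latticePoint, Real.norm_eq_abs] at h1
    rw [abs_div, abs_of_pos ht, div_le_iff₀ ht] at h1
    have h2 : |(m : ℝ) * k i| ≤ |(c i : ℝ) + m * k i| + |(c i : ℝ)| := by
      have := abs_sub ((c i : ℝ) + m * k i) (c i)
      simpa using this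
    rw [abs_mul, abs_of_pos (by linarith : (0 : ℝ) < m)] at h2
    nlinarith [abs_nonneg (k i : ℝ)]
  constructor <;> intro i
  · have := (neg_le_neg ((key i).trans (Int.le_ceil _))).trans (neg_abs_le (k i : ℝ))
    exact_mod_cast this
  · have := (le_abs_self (k i : ℝ)).trans ((key i).trans (Int.le_ceil _))
    exact_mod_cast this

lemma volume_latticePoint_floor_mem {ι : Type*} [Fintype ι] {s : Set (ι → ℝ)}
    (hb : Bornology.IsBounded s) (c : ι → ℤ) {m : ℕ} (hm : 1 ≤ m) {t : ℝ} (ht : 0 < t) :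
    MeasureTheory.volume {x : ι → ℝ | latticePoint c m t (fun i => ⌊t * x i / m⌋) ∈ s} =
      ENNReal.ofReal ({k : ι → ℤ | latticePoint c m t k ∈ s}.ncard *
        (m / t) ^ Fintype.card ι) := by
  have hm' : (0 : ℝ) < m := by exact_mod_cast hm
  have hfin := finite_latticePoint_mem hb c hm ht
  have hcell : ∀ (k : ι → ℤ) (x : ι → ℝ), (fun i => ⌊t * x i / m⌋) = k ↔
      x ∈ Set.pi Set.univ (fun i => Set.Ico (m / t * k i) (m / t * k i + m / t)) := by
    intro k x
    simp only [funext_iff, Set.mem_pi, Set.mem_univ, true_imp_iff, Set.mem_Ico, Int.floor_eq_iff]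
    refine forall_congr' fun i => ?_
    rw [le_div_iff₀ hm', div_lt_iff₀ hm', div_mul_eq_mul_div, div_le_iff₀ ht, ← add_div,
      lt_div_iff₀ ht]
    constructor <;> rintro ⟨h1, h2⟩ <;> constructor <;> linarith
  have hset : {x : ι → ℝ | latticePoint c m t (fun i => ⌊t * x i / m⌋) ∈ s} =
      ⋃ k ∈ hfin.toFinset,
        Set.pi Set.univ (fun i => Set.Ico (m / t * (k i : ℝ)) (m / t * k i + m / t)) := by
    ext x
    simp only [Set.mem_ofPred_eq, Set.mem_iUnion, Set.Finite.mem_toFinset, exists_prop, ← hcell]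
    simp
  rw [hset, MeasureTheory.measure_biUnion_finset]
  · simp only [Real.volume_pi_Ico, add_sub_cancel_left, Finset.prod_const, Finset.card_univ,
      Finset.sum_const, nsmul_eq_mul]
    rw [ENNReal.ofReal_mul (by positivity), ENNReal.ofReal_pow (by positivity),
      ENNReal.ofReal_natCast, Set.ncard_eq_toFinset_card _ hfin]
  · intro k _ k' _ hkk'
    refine Set.disjoint_left.2 fun x hx hx' => hkk' ?_
    rw [← (hcell k x).2 hx, (hcell k' x).2 hx']
  · intro k _
    exact MeasurableSet.univ_pi fun i => measurableSet_Ico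

/-- Lattice points of a translated, scaled lattice in a bounded set with null frontier are counted
by the volume. -/
theorem tendsto_ncard_latticePoint {ι : Type*} [Fintype ι] {s : Set (ι → ℝ)}
    (hb : Bornology.IsBounded s) (hs : MeasurableSet s)
    (hf : MeasureTheory.volume (frontier s) = 0) (c : ι → ℤ) {m : ℕ} (hm : 1 ≤ m) :
    Tendsto (fun t : ℝ => ({k : ι → ℤ | latticePoint c m t k ∈ s}.ncard : ℝ) *
      (m / t) ^ Fintype.card ι) atTop (nhds (MeasureTheory.volume.real s)) := by
  obtain ⟨r, hr⟩ := hb.subset_closedBall 0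
  have hfinite : MeasureTheory.volume s ≠ ⊤ := hb.measure_lt_top.ne
  have hlim : Tendsto (fun t : ℝ => MeasureTheory.volume
      {x : ι → ℝ | latticePoint c m t (fun i => ⌊t * x i / m⌋) ∈ s}) atTop
      (nhds (MeasureTheory.volume s)) := by
    refine MeasureTheory.tendsto_measure_of_ae_tendsto_indicator atTop hs ?_
      (B := Metric.closedBall 0 (r + (‖fun i => (c i : ℝ)‖ + m)))
      Metric.isClosed_closedBall.measurableSet
      Metric.isBounded_closedBall.measure_lt_top.ne ?_ ?_
    · intro t
      refine hs.preimage ?_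
      unfold latticePoint
      fun_prop
    · filter_upwards [eventually_ge_atTop 1] with t ht x hx
      have h1 := hr hx
      have ht0 : 0 < t := by linarith
      rw [mem_closedBall_zero_iff] at h1 ⊢
      have h2 : ‖latticePoint c m t (fun i => ⌊t * x i / m⌋) - x‖ ≤
          ‖fun i => (c i : ℝ)‖ + m := by
        refine (pi_norm_le_iff_of_nonneg (by positivity)).2 fun i => ?_
        refine (abs_latticePoint_floor_sub_le c hm ht0 x i).trans ?_
        refine (mul_le_of_le_one_right (by positivity) (inv_le_one_of_one_le₀ ht)).trans ?_
        gcongr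
        exact norm_le_pi_norm (fun i => (c i : ℝ)) i
      have h3 := norm_sub_norm_le x (latticePoint c m t (fun i => ⌊t * x i / m⌋))
      rw [norm_sub_rev] at h3
      linarith
    · have : ∀ᵐ x : ι → ℝ, x ∉ frontier s := MeasureTheory.measure_eq_zero_iff_ae_notMem.1 hf
      filter_upwards [this] with x hx
      have hlim := tendsto_latticePoint_floor c hm x
      by_cases hxs : x ∈ s
      · have : x ∈ interior s := by
          by_contra h
          exact hx ⟨subset_closure hxs, h⟩
        filter_upwards [hlim (mem_interior_iff_mem_nhds.1 this)] with t ht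
        exact ⟨fun _ => hxs, fun _ => ht⟩
      · have : x ∈ (closure s)ᶜ := by
          intro h
          exact hx ⟨h, fun h' => hxs (interior_subset h')⟩
        filter_upwards [hlim (isClosed_closure.isOpen_compl.mem_nhds this)] with t ht
        exact ⟨fun h => absurd (subset_closure h) ht, fun h => absurd h hxs⟩
  have hlim' := (ENNReal.tendsto_toReal hfinite).comp hlim
  refine hlim'.congr' ?_
  filter_upwards [eventually_gt_atTop 0] with t ht
  simp only [Function.comp_apply]
  rw [volume_latticePoint_floor_mem hb c hm ht, ENNReal.toReal_ofReal (by positivity)]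

/-- The coefficient vector of `Re (ω (x + z y)² (x + z' y))`, as a function of `(u, v, p, q)`. -/
noncomputable def cubicMap (e : ℝ) (w : Fin 4 → ℝ) : Fin 4 → ℝ :=
  ![w 2, cubB e (w 2) (w 3) (w 0) (w 1), cubC e (w 2) (w 3) (w 0) (w 1),
    cubD e (w 2) (w 3) (w 0) (w 1)]

/-- The Jacobian matrix of `cubicMap`. -/
noncomputable def cubicJacobian (e : ℝ) (w : Fin 4 → ℝ) : Matrix (Fin 4) (Fin 4) ℝ :=
  !![0, 0, 1, 0;
    3 * w 2, -(2 + e) * w 3, 3 * w 0, -(2 + e) * w 1;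
    6 * w 2 * w 0 - (4 + 2 * e) * w 3 * w 1,
      -2 * (1 + 2 * e) * w 2 * w 1 - (4 + 2 * e) * w 3 * w 0,
      3 * w 0 ^ 2 - (1 + 2 * e) * w 1 ^ 2, -(4 + 2 * e) * w 0 * w 1;
    w 2 * (3 * w 0 ^ 2 - (1 + 2 * e) * w 1 ^ 2) - 2 * (2 + e) * w 3 * w 0 * w 1,
      -2 * (1 + 2 * e) * w 2 * w 0 * w 1 - w 3 * ((2 + e) * w 0 ^ 2 - 3 * e * w 1 ^ 2),
      w 0 ^ 3 - (1 + 2 * e) * w 0 * w 1 ^ 2, -((2 + e) * w 0 ^ 2 * w 1 - e * w 1 ^ 3)]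

lemma det_cubicJacobian {e : ℝ} (he : e = 1 ∨ e = -1) (w : Fin 4 → ℝ) :
    |(cubicJacobian e w).det| = (20 + 16 * e) * (w 1 ^ 4 * (w 2 ^ 2 + w 3 ^ 2)) := by
  have h : (cubicJacobian e w).det = (16 + 20 * e) * (w 1 ^ 4 * (w 2 ^ 2 + w 3 ^ 2)) := by
    rcases he with rfl | rfl <;>
    · simp [cubicJacobian, Matrix.det_succ_row_zero, Fin.sum_univ_succ, Fin.succAbove]
      ring
  have h0 : |16 + 20 * e| = 20 + 16 * e := by rcases he with rfl | rfl <;> norm_num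
  rw [h, abs_mul, h0, abs_of_nonneg (a := w 1 ^ 4 * (w 2 ^ 2 + w 3 ^ 2)) (by positivity)]

lemma hasStrictFDerivAt_cubicMap (e : ℝ) (w : Fin 4 → ℝ) :
    HasStrictFDerivAt (cubicMap e)
      (LinearMap.toContinuousLinearMap (Matrix.toLin' (cubicJacobian e w))) w := by
  have hw : ∀ i, HasStrictFDerivAt (fun w : Fin 4 → ℝ => w i)
      (ContinuousLinearMap.proj (R := ℝ) (φ := fun _ : Fin 4 => ℝ) i) w :=
    fun i => hasStrictFDerivAt_apply i w
  have hu := hw 0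
  have hv := hw 1
  have hp := hw 2
  have hq := hw 3
  rw [hasStrictFDerivAt_pi']
  intro i
  fin_cases i
  · refine hp.congr_fderiv ?_
    ext x
    simp [cubicJacobian, Matrix.vecHead, Matrix.vecTail]
  · refine (((hp.const_mul 3).mul hu).sub ((hq.const_mul (2 + e)).mul hv)).congr_fderiv ?_
    ext x
    simp [cubicJacobian, Matrix.vecHead, Matrix.vecTail]
    ring
  · refine ((hp.mul (((hu.pow 2).const_mul 3).sub ((hv.pow 2).const_mul (1 + 2 * e)))).sub
      (hq.mul ((hu.const_mul (4 + 2 * e)).mul hv))).congr_fderiv ?_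
    ext x
    simp [cubicJacobian, Matrix.vecHead, Matrix.vecTail]
    ring
  · refine ((hp.mul ((hu.pow 3).sub ((hu.const_mul (1 + 2 * e)).mul (hv.pow 2)))).sub
      (hq.mul ((((hu.pow 2).const_mul (2 + e)).mul hv).sub
        ((hv.pow 3).const_mul e)))).congr_fderiv ?_
    ext x
    simp [cubicJacobian, Matrix.vecHead, Matrix.vecTail]
    ring

lemma det_toLin'_cubicJacobian {e : ℝ} (he : e = 1 ∨ e = -1) (w : Fin 4 → ℝ) :
    |(LinearMap.toContinuousLinearMap (Matrix.toLin' (cubicJacobian e w))).det| =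
      (20 + 16 * e) * (w 1 ^ 4 * (w 2 ^ 2 + w 3 ^ 2)) := by
  rw [← det_cubicJacobian he, ← LinearMap.det_toLin' (cubicJacobian e w)]
  rfl

lemma continuous_cubicMap (e : ℝ) : Continuous (cubicMap e) :=
  continuous_iff_continuousAt.2 fun w => (hasStrictFDerivAt_cubicMap e w).continuousAt

lemma cubicMap_smul (e t u v p q : ℝ) :
    cubicMap e ![u, v, t * p, t * q] = t • cubicMap e ![u, v, p, q] := by
  ext i
  fin_cases i <;> simp [cubicMap, cubB, cubC, cubD] <;> ring

lemma isOpen_image_cubicMap {e : ℝ} (he : e = 1 ∨ e = -1) {s : Set (Fin 4 → ℝ)} (hs : IsOpen s)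
    (hne : ∀ w ∈ s, 0 < w 1 ∧ 0 < w 2) : IsOpen (cubicMap e '' s) := by
  rw [isOpen_iff_mem_nhds]
  rintro _ ⟨w, hw, rfl⟩
  have hdet : LinearMap.det (Matrix.toLin' (cubicJacobian e w)) ≠ 0 := by
    rw [LinearMap.det_toLin', ← abs_ne_zero, det_cubicJacobian he]
    obtain ⟨h1, h2⟩ := hne w hw
    have : 0 < 20 + 16 * e := by rcases he with rfl | rfl <;> norm_num
    positivity
  have hsurj : (LinearMap.toContinuousLinearMap (Matrix.toLin' (cubicJacobian e w))).range = ⊤ :=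
    LinearMap.range_eq_top.2
      (LinearMap.equivOfDetNeZero (Matrix.toLin' (cubicJacobian e w)) hdet).surjective
  rw [← (hasStrictFDerivAt_cubicMap e w).map_nhds_eq_of_surj hsurj]
  exact image_mem_map (hs.mem_nhds hw)

lemma injOn_cubicMap {e : ℝ} (he : e = 1 ∨ e = -1) {s : Set (Fin 4 → ℝ)}
    (hne : ∀ w ∈ s, 0 < w 1 ∧ 0 < w 2) : Set.InjOn (cubicMap e) s := by
  intro w hw w' hw' h
  have h0 := congrFun h 0
  have h1 := congrFun h 1
  have h2 := congrFun h 2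
  have h3 := congrFun h 3
  simp only [cubicMap, Matrix.cons_val] at h0 h1 h2 h3
  rw [← h0] at h1 h2 h3
  obtain ⟨hq, hu, hv⟩ := param_injective he (hne w hw).2.ne' (hne w hw).1 (hne w' hw').1 h1 h2 h3
  ext i
  fin_cases i
  exacts [hu, hv, h0, hq]

lemma lintegral_fin_succ {n : ℕ} (F : (Fin (n + 1) → ℝ) → ENNReal) (hF : Measurable F) :
    ∫⁻ w, F w = ∫⁻ a : ℝ, ∫⁻ x : Fin n → ℝ, F (Matrix.vecCons a x) := by
  have h := (MeasureTheory.volume_preserving_piFinSuccAbove (fun _ : Fin (n + 1) => ℝ) 0).symm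
  rw [← h.lintegral_comp hF, MeasureTheory.Measure.volume_eq_prod,
    MeasureTheory.lintegral_prod
      (fun z => F ((MeasurableEquiv.piFinSuccAbove (fun _ : Fin (n + 1) => ℝ) 0).symm z))
      (hF.comp h.measurable).aemeasurable]
  refine MeasureTheory.lintegral_congr fun a => MeasureTheory.lintegral_congr fun x => ?_
  congr 1
  ext i
  refine Fin.cases ?_ (fun i => ?_) i <;> simp [Fin.insertNthEquiv]

lemma lintegral_fin_four (F : (Fin 4 → ℝ) → ENNReal) (hF : Measurable F) :
    ∫⁻ w, F w = ∫⁻ a : ℝ, ∫⁻ b : ℝ, ∫⁻ c : ℝ, ∫⁻ d : ℝ, F ![a, b, c, d] := by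
  have hc : ∀ {n : ℕ} (a : ℝ), Measurable (Matrix.vecCons a : (Fin n → ℝ) → Fin (n + 1) → ℝ) := by
    intro n a
    refine measurable_pi_lambda _ fun i => ?_
    refine Fin.cases ?_ (fun i => ?_) i
    · simp
    · simpa using measurable_pi_apply i
  rw [lintegral_fin_succ F hF]
  refine MeasureTheory.lintegral_congr fun a => ?_
  refine (lintegral_fin_succ (fun x => F (Matrix.vecCons a x)) (hF.comp (hc a))).trans ?_
  refine MeasureTheory.lintegral_congr fun b => ?_
  refine (lintegral_fin_succ (fun x => F (Matrix.vecCons a (Matrix.vecCons b x)))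
    ((hF.comp (hc a)).comp (hc b))).trans ?_
  refine MeasureTheory.lintegral_congr fun c => ?_
  refine (lintegral_fin_succ
    (fun x => F (Matrix.vecCons a (Matrix.vecCons b (Matrix.vecCons c x))))
    (((hF.comp (hc a)).comp (hc b)).comp (hc c))).trans ?_
  refine MeasureTheory.lintegral_congr fun d => ?_
  rw [MeasureTheory.Measure.volume_pi_eq_dirac ![], MeasureTheory.lintegral_dirac]

/-- A measurable set in `ℝ⁴` is null as soon as iterated slices are null. -/
lemma volume_fin_four_eq_zero {s : Set (Fin 4 → ℝ)} (hs : MeasurableSet s)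
    (h : ∀ᵐ a : ℝ, ∀ᵐ b : ℝ, ∀ᵐ c : ℝ, ∀ᵐ d : ℝ, ![a, b, c, d] ∉ s) :
    MeasureTheory.volume s = 0 := by
  rw [← MeasureTheory.lintegral_indicator_one hs,
    lintegral_fin_four _ (measurable_one.indicator hs), ← MeasureTheory.lintegral_zero (α := ℝ)]
  refine MeasureTheory.lintegral_congr_ae ?_
  filter_upwards [h] with a ha
  rw [← MeasureTheory.lintegral_zero (α := ℝ)]
  refine MeasureTheory.lintegral_congr_ae ?_
  filter_upwards [ha] with b hb
  rw [← MeasureTheory.lintegral_zero (α := ℝ)]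
  refine MeasureTheory.lintegral_congr_ae ?_
  filter_upwards [hb] with c hc
  rw [← MeasureTheory.lintegral_zero (α := ℝ)]
  refine MeasureTheory.lintegral_congr_ae ?_
  filter_upwards [hc] with d hd
  simp [hd]

lemma lintegral_Ioo_of_hasDerivAt {F f : ℝ → ℝ} {a b : ℝ} (hab : a ≤ b)
    (hF : ∀ x ∈ Set.Icc a b, HasDerivAt F (f x) x) (hf : ContinuousOn f (Set.Icc a b))
    (h0 : ∀ x ∈ Set.Icc a b, 0 ≤ f x) :
    ∫⁻ x in Set.Ioo a b, ENNReal.ofReal (f x) = ENNReal.ofReal (F b - F a) := by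
  have hi : IntervalIntegrable f MeasureTheory.volume a b := by
    apply ContinuousOn.intervalIntegrable
    rwa [Set.uIcc_of_le hab]
  have h1 : ∫ x in a..b, f x = F b - F a :=
    intervalIntegral.integral_eq_sub_of_hasDerivAt
      (fun x hx => hF x (by rwa [Set.uIcc_of_le hab] at hx)) hi
  have hii : MeasureTheory.IntegrableOn f (Set.Ioo a b) :=
    (intervalIntegrable_iff_integrableOn_Ioo_of_le hab).1 hi
  rw [← h1, intervalIntegral.integral_of_le hab, MeasureTheory.integral_Ioc_eq_integral_Ioo,
    MeasureTheory.ofReal_integral_eq_lintegral_ofReal hii]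
  rw [Filter.EventuallyLE, MeasureTheory.ae_restrict_iff' measurableSet_Ioo]
  exact Eventually.of_forall fun x hx => h0 x (Set.Ioo_subset_Icc_self hx)

lemma lintegral_half_disc {ρ : ℝ} (hρ : 0 < ρ) :
    ∫⁻ c : ℝ, ∫⁻ d : ℝ, Set.indicator {z : ℝ × ℝ | 0 < z.1 ∧ z.1 ^ 2 + z.2 ^ 2 < ρ ^ 2}
      (fun z => ENNReal.ofReal (z.1 ^ 2 + z.2 ^ 2)) (c, d) = ENNReal.ofReal (π * ρ ^ 4 / 4) := by
  have hmeas : MeasurableSet {z : ℝ × ℝ | 0 < z.1 ∧ z.1 ^ 2 + z.2 ^ 2 < ρ ^ 2} :=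
    (measurableSet_lt measurable_const measurable_fst).inter (measurableSet_lt
      (f := fun z : ℝ × ℝ => z.1 ^ 2 + z.2 ^ 2) (by fun_prop) measurable_const)
  have hF : Measurable (Set.indicator {z : ℝ × ℝ | 0 < z.1 ∧ z.1 ^ 2 + z.2 ^ 2 < ρ ^ 2}
      (fun z => ENNReal.ofReal (z.1 ^ 2 + z.2 ^ 2))) :=
    Measurable.indicator (by fun_prop) hmeas
  rw [← MeasureTheory.lintegral_prod _ hF.aemeasurable, ← MeasureTheory.Measure.volume_eq_prod,
    ← lintegral_comp_polarCoord_symm]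
  have hset : Set.Ioo 0 ρ ×ˢ Set.Ioo (-(π / 2)) (π / 2) ⊆ polarCoord.target := by
    rintro ⟨r, θ⟩ ⟨hr, hθ⟩
    refine ⟨hr.1, ?_, ?_⟩
    · have := hθ.1
      simp only at this ⊢
      linarith [pi_pos]
    · have := hθ.2
      simp only at this ⊢
      linarith [pi_pos]
  have hpt : ∀ z ∈ polarCoord.target, ENNReal.ofReal z.1 •
      Set.indicator {z : ℝ × ℝ | 0 < z.1 ∧ z.1 ^ 2 + z.2 ^ 2 < ρ ^ 2}
        (fun z => ENNReal.ofReal (z.1 ^ 2 + z.2 ^ 2)) (polarCoord.symm z) =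
      Set.indicator (Set.Ioo 0 ρ ×ˢ Set.Ioo (-(π / 2)) (π / 2))
        (fun z : ℝ × ℝ => ENNReal.ofReal (z.1 ^ 3) * 1) z := by
    rintro ⟨r, θ⟩ ⟨hr, hθ⟩
    simp only [Set.mem_Ioi] at hr
    have hsq : (r * cos θ) ^ 2 + (r * sin θ) ^ 2 = r ^ 2 := by
      rw [mul_pow, mul_pow, ← mul_add, cos_sq_add_sin_sq, mul_one]
    have hiff : (0 < r * cos θ ∧ r ^ 2 < ρ ^ 2) ↔
        (r, θ) ∈ Set.Ioo 0 ρ ×ˢ Set.Ioo (-(π / 2)) (π / 2) := by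
      rw [mul_pos_iff_of_pos_left hr, sq_lt_sq₀ hr.le hρ.le]
      constructor
      · rintro ⟨h1, h2⟩
        refine ⟨⟨hr, h2⟩, ?_, ?_⟩
        · by_contra! h
          have := cos_nonpos_of_pi_div_two_le_of_le (x := -θ) (by simp only at h; linarith)
            (by linarith [hθ.1, pi_pos])
          rw [cos_neg] at this
          linarith
        · by_contra! h
          have := cos_nonpos_of_pi_div_two_le_of_le (x := θ) h (by linarith [hθ.2, pi_pos])
          linarith
      · rintro ⟨h1, h2⟩
        exact ⟨cos_pos_of_mem_Ioo h2, h1.2⟩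
    by_cases hm : (r, θ) ∈ Set.Ioo 0 ρ ×ˢ Set.Ioo (-(π / 2)) (π / 2)
    · rw [Set.indicator_of_mem hm, Set.indicator_of_mem]
      · simp only [polarCoord_symm_apply, hsq, smul_eq_mul, mul_one]
        rw [← ENNReal.ofReal_mul hr.le]
        congr 1
        ring
      · simpa only [Set.mem_ofPred_eq, polarCoord_symm_apply, hsq] using hiff.2 hm
    · rw [Set.indicator_of_notMem hm, Set.indicator_of_notMem, smul_zero]
      simpa only [Set.mem_ofPred_eq, polarCoord_symm_apply, hsq] using fun h => hm (hiff.1 h)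
  rw [MeasureTheory.setLIntegral_congr_fun polarCoord.open_target.measurableSet hpt,
    MeasureTheory.setLIntegral_indicator (measurableSet_Ioo.prod measurableSet_Ioo),
    Set.inter_eq_left.2 hset, MeasureTheory.Measure.volume_eq_prod,
    ← MeasureTheory.Measure.prod_restrict,
    MeasureTheory.lintegral_prod_mul (f := fun r : ℝ => ENNReal.ofReal (r ^ 3))
      (g := fun _ : ℝ => 1) (by fun_prop) (by fun_prop),
    lintegral_Ioo_of_hasDerivAt (F := fun r => r ^ 4 / 4) hρ.le]
  · rw [MeasureTheory.lintegral_one, MeasureTheory.Measure.restrict_apply_univ, Real.volume_Ioo,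
      ← ENNReal.ofReal_mul (by norm_num; positivity)]
    congr 1
    ring
  · intro x _
    refine ((hasDerivAt_pow 4 x).div_const 4).congr_deriv ?_
    norm_num
  · fun_prop
  · intro x hx
    have := hx.1
    positivity

lemma lintegral_inv_sq {K a V : ℝ} (hK : 0 ≤ K) (ha : 0 < a) (haV : a ≤ V) :
    ∫⁻ b in Set.Ioo a V, ENNReal.ofReal (K * (b ^ 2)⁻¹) = ENNReal.ofReal (K * (1 / a - 1 / V)) := by
  rw [lintegral_Ioo_of_hasDerivAt (F := fun b => -(K * b⁻¹)) haV]
  · congr 1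
    ring
  · intro x hx
    have hx0 : x ≠ 0 := (ha.trans_le hx.1).ne'
    refine (((hasDerivAt_inv hx0).const_mul K).neg).congr_deriv ?_
    ring
  · refine ContinuousOn.mul continuousOn_const (ContinuousOn.inv₀ (by fun_prop) ?_)
    intro x hx
    exact pow_ne_zero 2 (ha.trans_le hx.1).ne'
  · intro x _
    positivity

lemma lintegral_inv_sqrt {K V : ℝ} (hK : 0 ≤ K) (hV : 1 ≤ V) :
    ∫⁻ a in Set.Ioo (0 : ℝ) (1 / 2), ENNReal.ofReal (K * (1 / √(1 - a ^ 2) - 1 / V)) =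
      ENNReal.ofReal (K * (π / 6 - 1 / (2 * V))) := by
  have hlt : ∀ x ∈ Set.Icc (0 : ℝ) (1 / 2), 0 < 1 - x ^ 2 := by
    intro x hx
    nlinarith [hx.1, hx.2]
  rw [lintegral_Ioo_of_hasDerivAt (F := fun a => K * (arcsin a - a / V)) (by norm_num)]
  · have : arcsin (1 / 2) = π / 6 := by
      rw [← sin_pi_div_six, arcsin_sin] <;> linarith [pi_pos]
    rw [this, arcsin_zero]
    congr 1
    field_simp
    ring
  · intro x hx
    exact (((hasDerivAt_arcsin (by linarith [hx.1]) (by linarith [hx.2])).sub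
      ((hasDerivAt_id x).div_const V)).const_mul K)
  · refine ContinuousOn.mul continuousOn_const (ContinuousOn.sub (ContinuousOn.div₀
      continuousOn_const (by fun_prop) ?_) continuousOn_const)
    intro x hx
    exact (sqrt_pos.2 (hlt x hx)).ne'
  · intro x hx
    have h1 : √(1 - x ^ 2) ≤ 1 := by
      rw [sqrt_le_left (by norm_num)]
      nlinarith
    have h2 : 1 ≤ 1 / √(1 - x ^ 2) := by
      rw [le_div_iff₀ (sqrt_pos.2 (hlt x hx))]
      linarith
    have h3 : 1 / V ≤ 1 := by
      rw [div_le_iff₀] <;> linarith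
    have : 0 ≤ 1 / √(1 - x ^ 2) - 1 / V := by linarith
    positivity

/-- The open domain of strictly reduced parameters `(u, v, p, q)` with `v < V` and discriminant of
absolute value less than `1`. -/
def innerDomain (e V : ℝ) : Set (Fin 4 → ℝ) :=
  {w | 0 < w 0 ∧ w 0 < 1 / 2 ∧ 0 < w 1 ∧ w 1 < V ∧ 1 < w 0 ^ 2 + w 1 ^ 2 ∧ 0 < w 2 ∧
    (56 + 52 * e) * (w 1 ^ 6 * (w 2 ^ 2 + w 3 ^ 2) ^ 2) < 1}

/-- The closed domain of reduced parameters `(u, v, p, q)` with `v ≤ V` and discriminant of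
absolute value at most `1`. -/
def outerDomain (e V : ℝ) : Set (Fin 4 → ℝ) :=
  {w | 0 ≤ w 0 ∧ w 0 ≤ 1 / 2 ∧ 0 ≤ w 1 ∧ w 1 ≤ V ∧ 1 ≤ w 0 ^ 2 + w 1 ^ 2 ∧ 0 ≤ w 2 ∧
    (56 + 52 * e) * (w 1 ^ 6 * (w 2 ^ 2 + w 3 ^ 2) ^ 2) ≤ 1}

lemma isOpen_innerDomain (e V : ℝ) : IsOpen (innerDomain e V) := by
  refine IsOpen.inter (isOpen_lt (g := fun w : Fin 4 → ℝ => w 0) (by fun_prop) (by fun_prop)) ?_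
  refine IsOpen.inter (isOpen_lt (f := fun w : Fin 4 → ℝ => w 0) (by fun_prop) (by fun_prop)) ?_
  refine IsOpen.inter (isOpen_lt (g := fun w : Fin 4 → ℝ => w 1) (by fun_prop) (by fun_prop)) ?_
  refine IsOpen.inter (isOpen_lt (f := fun w : Fin 4 → ℝ => w 1) (by fun_prop) (by fun_prop)) ?_
  refine IsOpen.inter (isOpen_lt (g := fun w : Fin 4 → ℝ => w 0 ^ 2 + w 1 ^ 2)
    (by fun_prop) (by fun_prop)) ?_
  refine IsOpen.inter (isOpen_lt (g := fun w : Fin 4 → ℝ => w 2) (by fun_prop) (by fun_prop)) ?_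
  exact isOpen_lt (f := fun w : Fin 4 → ℝ => (56 + 52 * e) *
    (w 1 ^ 6 * (w 2 ^ 2 + w 3 ^ 2) ^ 2)) (g := fun _ => 1) (by fun_prop) (by fun_prop)

lemma isClosed_outerDomain (e V : ℝ) : IsClosed (outerDomain e V) := by
  refine IsClosed.inter (isClosed_le (g := fun w : Fin 4 → ℝ => w 0) (by fun_prop) (by fun_prop)) ?_
  refine IsClosed.inter (isClosed_le (f := fun w : Fin 4 → ℝ => w 0) (by fun_prop) (by fun_prop)) ?_
  refine IsClosed.inter (isClosed_le (g := fun w : Fin 4 → ℝ => w 1) (by fun_prop) (by fun_prop)) ?_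
  refine IsClosed.inter (isClosed_le (f := fun w : Fin 4 → ℝ => w 1) (by fun_prop) (by fun_prop)) ?_
  refine IsClosed.inter (isClosed_le (g := fun w : Fin 4 → ℝ => w 0 ^ 2 + w 1 ^ 2)
    (by fun_prop) (by fun_prop)) ?_
  refine IsClosed.inter (isClosed_le (g := fun w : Fin 4 → ℝ => w 2) (by fun_prop) (by fun_prop)) ?_
  exact isClosed_le (f := fun w : Fin 4 → ℝ => (56 + 52 * e) *
    (w 1 ^ 6 * (w 2 ^ 2 + w 3 ^ 2) ^ 2)) (g := fun _ => 1) (by fun_prop) (by fun_prop)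

lemma innerDomain_subset_outerDomain (e V : ℝ) : innerDomain e V ⊆ outerDomain e V := by
  rintro w ⟨h1, h2, h3, h4, h5, h6, h7⟩
  exact ⟨h1.le, h2.le, h3.le, h4.le, h5.le, h6.le, h7.le⟩

lemma isCompact_outerDomain {e : ℝ} (he : e = 1 ∨ e = -1) (V : ℝ) :
    IsCompact (outerDomain e V) := by
  refine Metric.isCompact_of_isClosed_isBounded (isClosed_outerDomain e V) ?_
  refine (Metric.isBounded_closedBall (x := (0 : Fin 4 → ℝ)) (r := |V| + 1)).subset ?_
  rintro w ⟨h1, h2, h3, h4, h5, h6, h7⟩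
  have hκ : 4 ≤ 56 + 52 * e := by rcases he with rfl | rfl <;> norm_num
  have hv2 : 3 / 4 ≤ w 1 ^ 2 := by nlinarith
  have hv6 : (3 / 4 : ℝ) ^ 3 ≤ w 1 ^ 6 := by
    rw [show w 1 ^ 6 = (w 1 ^ 2) ^ 3 by ring]
    gcongr
  have hsq : (w 2 ^ 2 + w 3 ^ 2) ^ 2 ≤ 1 := by
    have h8 : 4 * ((3 / 4 : ℝ) ^ 3 * (w 2 ^ 2 + w 3 ^ 2) ^ 2) ≤ 1 := by
      refine le_trans ?_ h7
      gcongr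
    nlinarith [sq_nonneg (w 2 ^ 2 + w 3 ^ 2)]
  have hsq' : w 2 ^ 2 + w 3 ^ 2 ≤ 1 := by nlinarith [sq_nonneg (w 2), sq_nonneg (w 3)]
  have h2' : |w 2| ≤ 1 := by
    rw [← sq_le_one_iff_abs_le_one]
    nlinarith [sq_nonneg (w 3)]
  have h3' : |w 3| ≤ 1 := by
    rw [← sq_le_one_iff_abs_le_one]
    nlinarith [sq_nonneg (w 2)]
  rw [mem_closedBall_zero_iff, pi_norm_le_iff_of_nonneg (by positivity)]
  have hV := abs_nonneg V
  intro i
  fin_cases i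
  · change |w 0| ≤ _
    rw [abs_of_nonneg h1]
    linarith
  · change |w 1| ≤ _
    rw [abs_of_nonneg h3]
    linarith [le_abs_self V]
  · change |w 2| ≤ _
    linarith
  · change |w 3| ≤ _
    linarith

lemma eq_sqrt_or_of_sq_eq {x y : ℝ} (h : x ^ 2 = y) : x = √y ∨ x = -√y := by
  have hy : 0 ≤ y := h ▸ sq_nonneg x
  rw [← sq_eq_sq_iff_eq_or_eq_neg, sq_sqrt hy, h]

lemma volume_outerDomain_diff_innerDomain {e : ℝ} (he : e = 1 ∨ e = -1) (V : ℝ) :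
    MeasureTheory.volume (outerDomain e V \ innerDomain e V) = 0 := by
  have hκ : 0 < 56 + 52 * e := by rcases he with rfl | rfl <;> norm_num
  refine volume_fin_four_eq_zero ((isClosed_outerDomain e V).measurableSet.diff
    (isOpen_innerDomain e V).measurableSet) ?_
  have hfin : ∀ s : Set ℝ, s.Finite → ∀ᵐ x : ℝ, x ∉ s := fun s hs => hs.countable.ae_notMem _
  filter_upwards [hfin {0, 1 / 2} (by simp)] with a ha
  filter_upwards [hfin {0, V, √(1 - a ^ 2), -√(1 - a ^ 2)} (by simp)] with b hb
  filter_upwards [hfin {0} (by simp)] with c hc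
  filter_upwards [hfin {√(√((56 + 52 * e) * b ^ 6)⁻¹ - c ^ 2),
    -√(√((56 + 52 * e) * b ^ 6)⁻¹ - c ^ 2)} (by simp)] with d hd
  simp only [Set.mem_insert_iff, Set.mem_singleton_iff, not_or] at ha hb hc hd
  rintro ⟨⟨h1, h2, h3, h4, h5, h6, h7⟩, hn⟩
  simp only [Matrix.cons_val] at h1 h2 h3 h4 h5 h6 h7
  apply hn
  refine ⟨lt_of_le_of_ne h1 (Ne.symm ha.1), lt_of_le_of_ne h2 ha.2,
    lt_of_le_of_ne h3 (Ne.symm hb.1), lt_of_le_of_ne h4 hb.2.1, lt_of_le_of_ne h5 ?_,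
    lt_of_le_of_ne h6 (Ne.symm hc), lt_of_le_of_ne h7 ?_⟩
  · intro h
    rcases eq_sqrt_or_of_sq_eq (x := b) (y := 1 - a ^ 2) (by
      simp only [Matrix.cons_val] at h; linarith) with h' | h'
    exacts [hb.2.2.1 h', hb.2.2.2 h']
  · intro h
    simp only [Matrix.cons_val] at h
    have hb0 : b ≠ 0 := hb.1
    have h8 : (c ^ 2 + d ^ 2) ^ 2 = ((56 + 52 * e) * b ^ 6)⁻¹ := by
      field_simp
      linarith
    have h9 : c ^ 2 + d ^ 2 = √((56 + 52 * e) * b ^ 6)⁻¹ := by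
      rw [← h8, sqrt_sq (by positivity)]
    rcases eq_sqrt_or_of_sq_eq (x := d) (y := √((56 + 52 * e) * b ^ 6)⁻¹ - c ^ 2)
      (by linarith) with h' | h'
    exacts [hd.1 h', hd.2 h']

lemma frontier_image_null {e : ℝ} (he : e = 1 ∨ e = -1) (V : ℝ) :
    MeasureTheory.volume (frontier (cubicMap e '' innerDomain e V)) = 0 ∧
      MeasureTheory.volume (frontier (cubicMap e '' outerDomain e V)) = 0 := by
  have himg : MeasureTheory.volume (cubicMap e '' (outerDomain e V \ innerDomain e V)) = 0 :=
    MeasureTheory.addHaar_image_eq_zero_of_differentiableOn_of_addHaar_eq_zero _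
      (fun w _ => (hasStrictFDerivAt_cubicMap e w).hasFDerivAt.differentiableAt.differentiableWithinAt)
      (volume_outerDomain_diff_innerDomain he V)
  have hopen : IsOpen (cubicMap e '' innerDomain e V) :=
    isOpen_image_cubicMap he (isOpen_innerDomain e V) fun w hw => ⟨hw.2.2.1, hw.2.2.2.2.2.1⟩
  have hclosed : IsClosed (cubicMap e '' outerDomain e V) :=
    ((isCompact_outerDomain he V).image (continuous_cubicMap e)).isClosed
  have hsub := Set.image_mono (f := cubicMap e) (innerDomain_subset_outerDomain e V)
  have hdiff : cubicMap e '' outerDomain e V \ cubicMap e '' innerDomain e V ⊆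
      cubicMap e '' (outerDomain e V \ innerDomain e V) := by
    rintro _ ⟨⟨w, hw, rfl⟩, hn⟩
    exact ⟨w, ⟨hw, fun h => hn ⟨w, h, rfl⟩⟩, rfl⟩
  constructor
  · refine MeasureTheory.measure_mono_null (Set.Subset.trans ?_ hdiff) himg
    rw [hopen.frontier_eq]
    exact Set.sdiff_subset_sdiff_left (closure_minimal hsub hclosed)
  · refine MeasureTheory.measure_mono_null (Set.Subset.trans ?_ hdiff) himg
    rw [hclosed.frontier_eq]
    exact Set.sdiff_subset_sdiff_right (interior_maximal hsub hopen)

lemma volume_image_outerDomain {e : ℝ} (he : e = 1 ∨ e = -1) (V : ℝ) :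
    MeasureTheory.volume (cubicMap e '' outerDomain e V) =
      MeasureTheory.volume (cubicMap e '' innerDomain e V) := by
  refine le_antisymm ?_ (MeasureTheory.measure_mono
    (Set.image_mono (innerDomain_subset_outerDomain e V)))
  have himg : MeasureTheory.volume (cubicMap e '' (outerDomain e V \ innerDomain e V)) = 0 :=
    MeasureTheory.addHaar_image_eq_zero_of_differentiableOn_of_addHaar_eq_zero _
      (fun w _ => (hasStrictFDerivAt_cubicMap e w).hasFDerivAt.differentiableAt.differentiableWithinAt)
      (volume_outerDomain_diff_innerDomain he V)
  calc MeasureTheory.volume (cubicMap e '' outerDomain e V)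
      = MeasureTheory.volume (cubicMap e '' innerDomain e V ∪
          cubicMap e '' (outerDomain e V \ innerDomain e V)) := by
        rw [← Set.image_union, Set.union_sdiff_cancel (innerDomain_subset_outerDomain e V)]
    _ ≤ _ := MeasureTheory.measure_union_le _ _
    _ = _ := by rw [himg, add_zero]

lemma volume_image_innerDomain {e : ℝ} (he : e = 1 ∨ e = -1) {V : ℝ} (hV : 1 ≤ V) :
    MeasureTheory.volume (cubicMap e '' innerDomain e V) =
      ENNReal.ofReal ((20 + 16 * e) * π / (4 * (56 + 52 * e)) * (π / 6 - 1 / (2 * V))) := by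
  have hκ : 0 < 56 + 52 * e := by rcases he with rfl | rfl <;> norm_num
  have hj : 0 < 20 + 16 * e := by rcases he with rfl | rfl <;> norm_num
  have hm := (isOpen_innerDomain e V).measurableSet
  set K := (20 + 16 * e) * π / (4 * (56 + 52 * e)) with hK
  have hK0 : 0 ≤ K := by positivity
  have hinj : Set.InjOn (cubicMap e) (innerDomain e V) :=
    injOn_cubicMap he fun w hw => ⟨hw.2.2.1, hw.2.2.2.2.2.1⟩
  have hmeasF : Measurable fun w : Fin 4 → ℝ =>
      ENNReal.ofReal ((20 + 16 * e) * (w 1 ^ 4 * (w 2 ^ 2 + w 3 ^ 2))) := by fun_prop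
  have h1 := MeasureTheory.lintegral_image_eq_lintegral_abs_det_fderiv_mul MeasureTheory.volume hm
    (fun w _ => (hasStrictFDerivAt_cubicMap e w).hasFDerivAt.hasFDerivWithinAt) hinj (fun _ => 1)
  simp only [det_toLin'_cubicJacobian he, mul_one, MeasureTheory.lintegral_one,
    MeasureTheory.Measure.restrict_apply_univ] at h1
  rw [h1, ← MeasureTheory.lintegral_indicator hm, lintegral_fin_four _ (hmeasF.indicator hm),
    ← lintegral_inv_sqrt hK0 hV, ← MeasureTheory.lintegral_indicator measurableSet_Ioo]
  refine MeasureTheory.lintegral_congr fun a => ?_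
  by_cases ha : a ∈ Set.Ioo (0 : ℝ) (1 / 2)
  swap
  · have : ∀ b c d : ℝ, ![a, b, c, d] ∉ innerDomain e V := fun b c d h => ha ⟨h.1, h.2.1⟩
    rw [Set.indicator_of_notMem ha]
    simp [this]
  have ha1 : 0 < 1 - a ^ 2 := by nlinarith [ha.1, ha.2]
  have ha2 : √(1 - a ^ 2) ≤ V := (sqrt_le_one.2 (by nlinarith)).trans hV
  rw [Set.indicator_of_mem ha, ← lintegral_inv_sq hK0 (sqrt_pos.2 ha1) ha2,
    ← MeasureTheory.lintegral_indicator measurableSet_Ioo]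
  refine MeasureTheory.lintegral_congr fun b => ?_
  by_cases hb : b ∈ Set.Ioo (√(1 - a ^ 2)) V
  swap
  · have : ∀ c d : ℝ, ![a, b, c, d] ∉ innerDomain e V := by
      rintro c d ⟨-, -, h3, h4, h5, -⟩
      simp only [Matrix.cons_val] at h3 h4 h5
      refine hb ⟨?_, h4⟩
      rw [sqrt_lt' h3]
      linarith
    simp [this, Set.indicator_of_notMem hb]
  have hb0 : 0 < b := (sqrt_nonneg _).trans_lt hb.1
  have hb1 : 1 < a ^ 2 + b ^ 2 := by
    have := (sqrt_lt' hb0).1 hb.1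
    linarith
  have hr0 : 0 < ((56 + 52 * e) * b ^ 6)⁻¹ := by positivity
  set ρ := √√((56 + 52 * e) * b ^ 6)⁻¹ with hρ
  have hρ0 : 0 < ρ := sqrt_pos.2 (sqrt_pos.2 hr0)
  have hρ2 : ρ ^ 2 = √((56 + 52 * e) * b ^ 6)⁻¹ := sq_sqrt (sqrt_nonneg _)
  have hρ4 : ρ ^ 4 = ((56 + 52 * e) * b ^ 6)⁻¹ := by
    rw [show ρ ^ 4 = (ρ ^ 2) ^ 2 by ring, hρ2, sq_sqrt hr0.le]
  have hpt : ∀ c d : ℝ, (innerDomain e V).indicator (fun w : Fin 4 → ℝ =>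
      ENNReal.ofReal ((20 + 16 * e) * (w 1 ^ 4 * (w 2 ^ 2 + w 3 ^ 2)))) ![a, b, c, d] =
      ENNReal.ofReal ((20 + 16 * e) * b ^ 4) *
        Set.indicator {z : ℝ × ℝ | 0 < z.1 ∧ z.1 ^ 2 + z.2 ^ 2 < ρ ^ 2}
          (fun z => ENNReal.ofReal (z.1 ^ 2 + z.2 ^ 2)) (c, d) := by
    intro c d
    have hiff : ![a, b, c, d] ∈ innerDomain e V ↔
        (c, d) ∈ {z : ℝ × ℝ | 0 < z.1 ∧ z.1 ^ 2 + z.2 ^ 2 < ρ ^ 2} := by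
      have h7 : (56 + 52 * e) * (b ^ 6 * (c ^ 2 + d ^ 2) ^ 2) < 1 ↔ c ^ 2 + d ^ 2 < ρ ^ 2 := by
        rw [hρ2, lt_sqrt (by positivity), ← one_div, lt_div_iff₀ (by positivity)]
        constructor <;> intro h <;> linarith
      constructor
      · rintro ⟨-, -, -, -, -, h6, h8⟩
        exact ⟨h6, h7.1 h8⟩
      · rintro ⟨h6, h8⟩
        exact ⟨ha.1, ha.2, hb0, hb.2, hb1, h6, h7.2 h8⟩
    by_cases hmem : ![a, b, c, d] ∈ innerDomain e V
    · rw [Set.indicator_of_mem hmem, Set.indicator_of_mem (hiff.1 hmem),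
        ← ENNReal.ofReal_mul (by positivity)]
      simp only [Matrix.cons_val]
      congr 1
      ring
    · rw [Set.indicator_of_notMem hmem, Set.indicator_of_notMem (fun h => hmem (hiff.2 h)),
        mul_zero]
  simp only [hpt]
  rw [Set.indicator_of_mem hb]
  simp only [MeasureTheory.lintegral_const_mul' _ _ ENNReal.ofReal_ne_top]
  rw [lintegral_half_disc hρ0, ← ENNReal.ofReal_mul (by positivity), hρ4]
  congr 1
  rw [hK]
  field_simp

lemma volume_real_image {e : ℝ} (he : e = 1 ∨ e = -1) {V : ℝ} (hV : 1 ≤ V) :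
    MeasureTheory.volume.real (cubicMap e '' innerDomain e V) =
        (20 + 16 * e) * π / (4 * (56 + 52 * e)) * (π / 6 - 1 / (2 * V)) ∧
      MeasureTheory.volume.real (cubicMap e '' outerDomain e V) =
        (20 + 16 * e) * π / (4 * (56 + 52 * e)) * (π / 6 - 1 / (2 * V)) := by
  have hκ : 0 < 56 + 52 * e := by rcases he with rfl | rfl <;> norm_num
  have hj : 0 < 20 + 16 * e := by rcases he with rfl | rfl <;> norm_num
  have h2 : 0 ≤ π / 6 - 1 / (2 * V) := by
    have : 1 / (2 * V) ≤ 1 / 2 := by gcongr; linarith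
    linarith [pi_gt_three]
  have h3 : 0 ≤ (20 + 16 * e) * π / (4 * (56 + 52 * e)) * (π / 6 - 1 / (2 * V)) := by positivity
  simp only [MeasureTheory.measureReal_def, volume_image_outerDomain he,
    volume_image_innerDomain he hV, ENNReal.toReal_ofReal h3, and_self]

lemma isBounded_image {e : ℝ} (he : e = 1 ∨ e = -1) (V : ℝ) :
    Bornology.IsBounded (cubicMap e '' innerDomain e V) ∧
      Bornology.IsBounded (cubicMap e '' outerDomain e V) := by
  have h := ((isCompact_outerDomain he V).image (continuous_cubicMap e)).isBounded
  exact ⟨h.subset (Set.image_mono (innerDomain_subset_outerDomain e V)), h⟩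

lemma measurableSet_image {e : ℝ} (he : e = 1 ∨ e = -1) (V : ℝ) :
    MeasurableSet (cubicMap e '' innerDomain e V) ∧
      MeasurableSet (cubicMap e '' outerDomain e V) :=
  ⟨(isOpen_image_cubicMap he (isOpen_innerDomain e V)
    fun _ hw => ⟨hw.2.2.1, hw.2.2.2.2.2.1⟩).measurableSet,
    ((isCompact_outerDomain he V).image (continuous_cubicMap e)).isClosed.measurableSet⟩

/-- The real coefficient vector of an integral binary cubic form. -/
def coeffVec (f : BinaryCubic) : Fin 4 → ℝ := ![f.1, f.2.1, f.2.2.1, f.2.2.2]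

/-- The integral binary cubic form with a given coefficient vector. -/
def formOfVec (k : Fin 4 → ℤ) : BinaryCubic := (k 0, k 1, k 2, k 3)

lemma hasParam_iff_coeffVec {e p q u v : ℝ} {f : BinaryCubic} :
    HasParam e p q u v f ↔ coeffVec f = cubicMap e ![u, v, p, q] := by
  constructor
  · rintro ⟨h0, h1, h2, h3⟩
    simp [coeffVec, cubicMap, h0, h1, h2, h3]
  · intro h
    exact ⟨congrFun h 0, congrFun h 1, congrFun h 2, congrFun h 3⟩

lemma formOfVec_injective : Function.Injective formOfVec := by
  intro k k' h
  simp only [formOfVec, Prod.mk.injEq] at h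
  ext i
  fin_cases i
  exacts [h.1, h.2.1, h.2.2.1, h.2.2.2]

lemma setOf_redMod_eq {m : ℕ} {t : ℝ} (s : Set (Fin 4 → ℝ))
    (c : Fin 4 → ℤ) :
    {f : BinaryCubic | redMod m f = redMod m (formOfVec c) ∧ t⁻¹ • coeffVec f ∈ s} =
      (fun k : Fin 4 → ℤ => formOfVec (fun i => c i + m * k i)) ''
        {k | latticePoint c m t k ∈ s} := by
  have hpt : ∀ k : Fin 4 → ℤ, t⁻¹ • coeffVec (formOfVec fun i => c i + m * k i) =
      latticePoint c m t k := by
    intro k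
    ext i
    fin_cases i <;> simp [coeffVec, formOfVec, latticePoint] <;> ring
  ext f
  constructor
  · rintro ⟨h1, h2⟩
    simp only [redMod, formOfVec, Prod.mk.injEq] at h1
    obtain ⟨ha, hb, hc, hd⟩ := h1
    obtain ⟨k0, hk0⟩ := (ZMod.intCast_eq_intCast_iff_dvd_sub _ _ _).1 ha.symm
    obtain ⟨k1, hk1⟩ := (ZMod.intCast_eq_intCast_iff_dvd_sub _ _ _).1 hb.symm
    obtain ⟨k2, hk2⟩ := (ZMod.intCast_eq_intCast_iff_dvd_sub _ _ _).1 hc.symm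
    obtain ⟨k3, hk3⟩ := (ZMod.intCast_eq_intCast_iff_dvd_sub _ _ _).1 hd.symm
    have hf : (formOfVec fun i => c i + m * ![k0, k1, k2, k3] i) = f := by
      obtain ⟨fa, fb, fc, fd⟩ := f
      simp only [formOfVec, Matrix.cons_val, Prod.mk.injEq]
      simp only at hk0 hk1 hk2 hk3
      refine ⟨?_, ?_, ?_, ?_⟩ <;> linarith
    refine ⟨![k0, k1, k2, k3], ?_, hf⟩
    change latticePoint _ _ _ _ ∈ s
    rw [← hpt, hf]
    exact h2
  · rintro ⟨k, hk, rfl⟩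
    refine ⟨?_, ?_⟩
    · simp [redMod, formOfVec]
    · rw [hpt]
      exact hk

lemma finite_coeffVec_mem {s : Set (Fin 4 → ℝ)} (hb : Bornology.IsBounded s) {t : ℝ}
    (ht : 0 < t) : {f : BinaryCubic | t⁻¹ • coeffVec f ∈ s}.Finite := by
  have h := setOf_redMod_eq (m := 1) (t := t) s 0
  have h1 : {f : BinaryCubic | t⁻¹ • coeffVec f ∈ s} =
      {f : BinaryCubic | redMod 1 f = redMod 1 (formOfVec 0) ∧ t⁻¹ • coeffVec f ∈ s} := by
    ext f
    exact ⟨fun h => ⟨Subsingleton.elim _ _, h⟩, fun h => h.2⟩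
  rw [h1, h]
  exact (finite_latticePoint_mem hb 0 le_rfl ht).image _

lemma tendsto_ncard_forms {m : ℕ} (hm : 1 ≤ m) (Sbar : Set (ZMod m × ZMod m × ZMod m × ZMod m))
    {s : Set (Fin 4 → ℝ)} (hb : Bornology.IsBounded s) (hs : MeasurableSet s)
    (hf : MeasureTheory.volume (frontier s) = 0) :
    Tendsto (fun t : ℝ =>
      ({f : BinaryCubic | redMod m f ∈ Sbar ∧ t⁻¹ • coeffVec f ∈ s}.ncard : ℝ) / t ^ 4) atTop
      (nhds ((Nat.card Sbar : ℝ) / (m : ℝ) ^ 4 * MeasureTheory.volume.real s)) := by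
  classical
  have : NeZero m := ⟨by omega⟩
  have hm0 : (m : ℝ) ≠ 0 := by exact_mod_cast (NeZero.ne m)
  have hrep : ∀ σ : ZMod m × ZMod m × ZMod m × ZMod m, ∃ c : Fin 4 → ℤ,
      redMod m (formOfVec c) = σ := by
    rintro ⟨a, b, c, d⟩
    obtain ⟨a', rfl⟩ := ZMod.intCast_surjective a
    obtain ⟨b', rfl⟩ := ZMod.intCast_surjective b
    obtain ⟨c', rfl⟩ := ZMod.intCast_surjective c
    obtain ⟨d', rfl⟩ := ZMod.intCast_surjective d
    exact ⟨![a', b', c', d'], rfl⟩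
  choose r hr using hrep
  have hinj : ∀ c : Fin 4 → ℤ, Function.Injective
      (fun k : Fin 4 → ℤ => formOfVec (fun i => c i + m * k i)) := by
    intro c k k' h
    have h1 := formOfVec_injective h
    ext i
    have h2 := congrFun h1 i
    have hm1 : (m : ℤ) ≠ 0 := by exact_mod_cast (NeZero.ne m)
    exact mul_left_cancel₀ hm1 (add_left_cancel h2)
  have hfin := Sbar.toFinite
  have hsum : Tendsto (fun t : ℝ => (∑ σ ∈ hfin.toFinset,
      ({k : Fin 4 → ℤ | latticePoint (r σ) m t k ∈ s}.ncard : ℝ) *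
        (m / t) ^ Fintype.card (Fin 4)) / (m : ℝ) ^ 4) atTop
      (nhds ((∑ σ ∈ hfin.toFinset, MeasureTheory.volume.real s) / (m : ℝ) ^ 4)) :=
    (tendsto_finsetSum _ fun σ _ => tendsto_ncard_latticePoint hb hs hf (r σ) hm).div_const _
  have hcard : (Nat.card Sbar : ℝ) / (m : ℝ) ^ 4 * MeasureTheory.volume.real s =
      (∑ σ ∈ hfin.toFinset, MeasureTheory.volume.real s) / (m : ℝ) ^ 4 := by
    rw [Finset.sum_const, nsmul_eq_mul, Nat.card_coe_set_eq, Set.ncard_eq_toFinset_card _ hfin]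
    ring
  rw [hcard]
  refine hsum.congr' ?_
  filter_upwards [eventually_gt_atTop 0] with t ht
  have hA : {f : BinaryCubic | redMod m f ∈ Sbar ∧ t⁻¹ • coeffVec f ∈ s}.Finite :=
    (finite_coeffVec_mem hb ht).subset fun f hf => hf.2
  have hcount : {f : BinaryCubic | redMod m f ∈ Sbar ∧ t⁻¹ • coeffVec f ∈ s}.ncard =
      ∑ σ ∈ hfin.toFinset, {k : Fin 4 → ℤ | latticePoint (r σ) m t k ∈ s}.ncard := by
    rw [Set.ncard_eq_toFinset_card _ hA, Finset.card_eq_sum_card_fiberwise (f := redMod m)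
      (t := hfin.toFinset)]
    · refine Finset.sum_congr rfl fun σ hσ => ?_
      rw [← Set.ncard_image_of_injective _ (hinj (r σ)), ← setOf_redMod_eq, hr,
        ← Set.ncard_coe_finset]
      congr 1
      ext f
      simp only [Finset.coe_filter, Set.Finite.mem_toFinset, Set.mem_ofPred_eq]
      rw [Set.Finite.mem_toFinset] at hσ
      constructor
      · rintro ⟨⟨_, h2⟩, h3⟩
        exact ⟨h3, h2⟩
      · rintro ⟨h3, h2⟩
        exact ⟨⟨h3 ▸ hσ, h2⟩, h3⟩
    · intro f hf
      simp only [Set.Finite.coe_toFinset, Set.mem_ofPred_eq] at hf ⊢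
      exact hf.1
  rw [hcount, Nat.cast_sum, ← Finset.sum_mul, Fintype.card_fin]
  field_simp

/-- Integral binary cubic forms with bounded coefficients. -/
noncomputable def formBox (A B C D : ℝ) : Finset BinaryCubic :=
  Finset.Icc (-⌊A⌋) ⌊A⌋ ×ˢ Finset.Icc (-⌊B⌋) ⌊B⌋ ×ˢ Finset.Icc (-⌊C⌋) ⌊C⌋ ×ˢ Finset.Icc (-⌊D⌋) ⌊D⌋

lemma mem_Icc_floor_iff {A : ℝ} {n : ℤ} : n ∈ Finset.Icc (-⌊A⌋) ⌊A⌋ ↔ |(n : ℝ)| ≤ A := by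
  rw [Finset.mem_Icc, ← abs_le, Int.le_floor]
  simp

lemma card_Icc_floor_le {A : ℝ} (hA : 1 ≤ A) :
    ((Finset.Icc (-⌊A⌋) ⌊A⌋).card : ℝ) ≤ 3 * A := by
  have h0 : 0 ≤ ⌊A⌋ := Int.floor_nonneg.2 (by linarith)
  have h : ((Finset.Icc (-⌊A⌋) ⌊A⌋).card : ℤ) = 2 * ⌊A⌋ + 1 := by
    rw [Int.card_Icc, Int.toNat_of_nonneg (by linarith)]
    ring
  have h' : ((Finset.Icc (-⌊A⌋) ⌊A⌋).card : ℝ) = 2 * ⌊A⌋ + 1 := by exact_mod_cast h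
  rw [h']
  linarith [Int.floor_le A]

lemma mem_formBox {A B C D : ℝ} {f : BinaryCubic} : f ∈ formBox A B C D ↔
    |(f.1 : ℝ)| ≤ A ∧ |(f.2.1 : ℝ)| ≤ B ∧ |(f.2.2.1 : ℝ)| ≤ C ∧ |(f.2.2.2 : ℝ)| ≤ D := by
  simp only [formBox, Finset.mem_product, mem_Icc_floor_iff]

lemma card_formBox_le {A B C D : ℝ} (hA : 1 ≤ A) (hB : 1 ≤ B) (hC : 1 ≤ C) (hD : 1 ≤ D) :
    ((formBox A B C D).card : ℝ) ≤ 3 * A * (3 * B * (3 * C * (3 * D))) := by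
  simp only [formBox, Finset.card_product, Nat.cast_mul]
  gcongr <;> exact card_Icc_floor_le ‹_›

/-- Forms with positive leading coefficient whose reduced parameter has imaginary part in `J`. -/
def cuspForms (e t : ℝ) (J : Set ℝ) : Set BinaryCubic :=
  {f | 1 ≤ f.1 ∧ ∃ p q u v, HasParam e p q u v f ∧ 0 ≤ u ∧ u ≤ 1 / 2 ∧ v ∈ J ∧
    v ^ 6 * (p ^ 2 + q ^ 2) ^ 2 ≤ t ^ 4}

lemma one_le_of_hasParam {e p q u v : ℝ} {f : BinaryCubic} (h : HasParam e p q u v f)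
    (hf : 1 ≤ f.1) : 1 ≤ p := by
  rw [← h.1]
  exact_mod_cast hf

lemma cuspForms_shell {e : ℝ} (he : e = 1 ∨ e = -1) {t W : ℝ} (ht : 0 < t) (hW : 1 ≤ W) :
    (cuspForms e t (Set.Ico W (2 * W))).Finite ∧
      ((cuspForms e t (Set.Ico W (2 * W))).ncard : ℝ) ≤ 1062882 * t ^ 4 / W := by
  set S := cuspForms e t (Set.Ico W (2 * W)) with hS
  rcases S.eq_empty_or_nonempty with hemp | ⟨f₀, hf₀⟩
  · rw [hemp]
    refine ⟨Set.finite_empty, ?_⟩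
    rw [Set.ncard_empty, Nat.cast_zero]
    positivity
  have hW0 : 0 < W := by linarith
  set A := t / √(W ^ 3) with hA
  have hA2 : A ^ 2 = t ^ 2 / W ^ 3 := by rw [hA, div_pow, sq_sqrt (by positivity)]
  have hA0 : 0 < A := by positivity
  have hbound : ∀ {p q v : ℝ}, W ≤ v → v ^ 6 * (p ^ 2 + q ^ 2) ^ 2 ≤ t ^ 4 →
      p ^ 2 + q ^ 2 ≤ A ^ 2 := by
    intro p q v hv h
    rw [hA2, le_div_iff₀ (by positivity)]
    have h1 : W ^ 6 * (p ^ 2 + q ^ 2) ^ 2 ≤ t ^ 4 := le_trans (by gcongr) h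
    refine (sq_le_sq₀ (by positivity) (by positivity)).1 ?_
    linarith
  have hA1 : 1 ≤ A := by
    obtain ⟨h1, p, q, u, v, hp, -, -, hv, h⟩ := hf₀
    have h2 := hbound hv.1 h
    have h3 := one_le_of_hasParam hp h1
    nlinarith [sq_nonneg q]
  set N := ⌊W⌋₊ with hN
  have hNW : (N : ℝ) ≤ W := Nat.floor_le hW0.le
  have hN1 : 1 ≤ N := Nat.one_le_floor_iff W |>.2 hW
  have hN2 : W ≤ 2 * N := by
    have h1 := (Nat.lt_floor_add_one W).le
    have h2 : (1 : ℝ) ≤ N := by exact_mod_cast hN1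
    linarith
  set box := formBox A (9 * A * W) (27 * A * W ^ 2) (27 * A * W ^ 3) with hbox
  have hmaps : ∀ x ∈ (Finset.range N : Set ℕ) ×ˢ S, translateForm (x.1 : ℤ) x.2 ∈ (box : Set _) := by
    rintro ⟨n, f⟩ ⟨hn, h1, p, q, u, v, hp, hu0, hu1, hv, h⟩
    have hn' : (n : ℝ) + 1 ≤ N := by
      have : n < N := by simpa using hn
      exact_mod_cast this
    obtain ⟨b1, b2, b3, b4⟩ := param_bounds (p := p) (q := q) (u := u + n) (v := v) he hA0.le
      (by positivity : 0 ≤ 3 * W) (hbound hv.1 h)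
      (by nlinarith [hv.1, hv.2, (Nat.cast_nonneg n : (0 : ℝ) ≤ n)])
    obtain ⟨c1, c2, c3, c4⟩ := hasParam_translateForm hp n
    rw [Finset.mem_coe, hbox, mem_formBox]
    push_cast at c1 c2 c3 c4
    rw [c1, c2, c3, c4]
    refine ⟨b1, b2.trans_eq (by ring), b3.trans_eq (by ring), b4.trans_eq (by ring)⟩
  have hinj : Set.InjOn (fun x : ℕ × BinaryCubic => translateForm (x.1 : ℤ) x.2)
      ((Finset.range N : Set ℕ) ×ˢ S) := by
    rintro ⟨n, f⟩ ⟨hn, h1, p, q, u, v, hp, hu0, hu1, hv, h⟩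
      ⟨n', f'⟩ ⟨hn', h1', p', q', u', v', hp', hu0', hu1', hv', h'⟩ heq
    simp only at heq hp hp' h1 h1'
    have hc := hasParam_translateForm hp n
    have hc' := hasParam_translateForm hp' n'
    rw [heq] at hc
    have hp1 := one_le_of_hasParam hp h1
    have hpp : p' = p := by rw [← hc.1, ← hc'.1]
    subst hpp
    obtain ⟨-, h3, -⟩ := param_injective (u := u + n) (u' := u' + n') he (by linarith)
      (hW0.trans_le hv.1) (hW0.trans_le hv'.1) (hc.2.1.symm.trans hc'.2.1)
      (hc.2.2.1.symm.trans hc'.2.2.1) (hc.2.2.2.symm.trans hc'.2.2.2)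
    have hnn : n = n' := by
      have i1 : (n : ℝ) < n' + 1 := by linarith
      have i2 : (n' : ℝ) < n + 1 := by linarith
      have i1' : n < n' + 1 := by exact_mod_cast i1
      have i2' : n' < n + 1 := by exact_mod_cast i2
      omega
    subst hnn
    rw [translateForm_injective _ heq]
  have hfin : S.Finite := by
    refine Set.Finite.of_injOn (f := translateForm 0) (t := (box : Set BinaryCubic)) ?_
      (translateForm_injective 0).injOn box.finite_toSet
    intro f hf
    exact hmaps (0, f) ⟨by simpa using Nat.lt_of_succ_le hN1, hf⟩
  refine ⟨hfin, ?_⟩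
  have hle := Set.ncard_le_ncard_of_injOn _ hmaps hinj box.finite_toSet
  rw [Set.ncard_prod, Set.ncard_coe_finset, Set.ncard_coe_finset, Finset.card_range] at hle
  have hle' : (N : ℝ) * S.ncard ≤ box.card := by exact_mod_cast hle
  have hAW : 1 ≤ A * W := by nlinarith
  have hAW2 : 1 ≤ A * W ^ 2 := by nlinarith
  have hAW3 : 1 ≤ A * W ^ 3 := by nlinarith [sq_nonneg W, mul_pos hA0 (pow_pos hW0 2)]
  have hcard := card_formBox_le hA1 (B := 9 * A * W) (C := 27 * A * W ^ 2) (D := 27 * A * W ^ 3)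
    (by linarith) (by linarith) (by linarith)
  have hA4 : A ^ 4 * W ^ 6 = t ^ 4 := by
    rw [show A ^ 4 = (A ^ 2) ^ 2 by ring, hA2]
    field_simp
  have htot : (N : ℝ) * S.ncard ≤ 531441 * t ^ 4 := by
    rw [← hA4]
    linarith
  rw [le_div_iff₀ hW0]
  nlinarith [(Nat.cast_nonneg S.ncard : (0 : ℝ) ≤ S.ncard)]

lemma cuspForms_tail {e : ℝ} (he : e = 1 ∨ e = -1) {t V : ℝ} (ht : 0 < t) (hV : 1 ≤ V) :
    (cuspForms e t (Set.Ici V)).Finite ∧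
      ((cuspForms e t (Set.Ici V)).ncard : ℝ) ≤ 2125764 * t ^ 4 / V := by
  obtain ⟨J, hJ⟩ := pow_unbounded_of_one_lt (t ^ 4) (one_lt_two (α := ℝ))
  have hV0 : 0 < V := by linarith
  have hW : ∀ j : ℕ, 1 ≤ 2 ^ j * V := fun j => one_le_mul_of_one_le_of_one_le
    (one_le_pow₀ one_le_two) hV
  have hsub : cuspForms e t (Set.Ici V) ⊆ ⋃ j ∈ Finset.range J,
      cuspForms e t (Set.Ico (2 ^ j * V) (2 * (2 ^ j * V))) := by
    rintro f ⟨h1, p, q, u, v, hp, hu0, hu1, hv, h⟩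
    simp only [Set.mem_Ici] at hv
    have hp1 := one_le_of_hasParam hp h1
    have hv1 : 1 ≤ v := hV.trans hv
    have hvt : v ≤ t ^ 4 := by
      have h2 : 1 ≤ (p ^ 2 + q ^ 2) ^ 2 := one_le_pow₀ (by nlinarith [sq_nonneg q])
      have h3 : v ≤ v ^ 6 := le_self_pow₀ hv1 (by norm_num)
      nlinarith [pow_pos (by linarith : 0 < v) 6]
    obtain ⟨j, hj1, hj2⟩ := exists_nat_pow_near (one_le_div hV0 |>.2 hv) (one_lt_two (α := ℝ))
    rw [le_div_iff₀ hV0] at hj1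
    rw [div_lt_iff₀ hV0, pow_succ'] at hj2
    have hjJ : j < J := by
      have h4 : (2 : ℝ) ^ j < 2 ^ J := by
        refine lt_of_le_of_lt ?_ hJ
        refine le_trans ?_ (hj1.trans hvt)
        exact le_mul_of_one_le_right (by positivity) hV
      exact (pow_lt_pow_iff_right₀ one_lt_two).1 h4
    simp only [Set.mem_iUnion, Finset.mem_range]
    exact ⟨j, hjJ, h1, p, q, u, v, hp, hu0, hu1, ⟨hj1, by linarith⟩, h⟩
  have hfin : (⋃ j ∈ Finset.range J,
      cuspForms e t (Set.Ico (2 ^ j * V) (2 * (2 ^ j * V)))).Finite :=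
    (Finset.range J).finite_toSet.biUnion fun j _ => (cuspForms_shell he ht (hW j)).1
  refine ⟨hfin.subset hsub, ?_⟩
  have h1 := (Set.ncard_le_ncard hsub hfin).trans (Finset.set_ncard_biUnion_le _ _)
  calc ((cuspForms e t (Set.Ici V)).ncard : ℝ)
      ≤ ∑ j ∈ Finset.range J,
        ((cuspForms e t (Set.Ico (2 ^ j * V) (2 * (2 ^ j * V)))).ncard : ℝ) := by
        exact_mod_cast h1
    _ ≤ ∑ j ∈ Finset.range J, 1062882 * t ^ 4 / V * (1 / 2) ^ j := by
        refine Finset.sum_le_sum fun j _ => ((cuspForms_shell he ht (hW j)).2).trans_eq ?_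
        rw [one_div, inv_pow]
        field_simp
    _ ≤ 1062882 * t ^ 4 / V * 2 := by
        rw [← Finset.mul_sum]
        gcongr
        exact sum_geometric_two_le J
    _ = _ := by ring

/-- Pairs `(s, A)` with `1 ≤ s` and `s |A| ≤ M`. -/
noncomputable def divisorPairs (M : ℕ) : Finset (Σ _ : ℕ, ℤ) :=
  (Finset.Icc 1 M).sigma fun s => Finset.Icc (-((M / s : ℕ) : ℤ)) ((M / s : ℕ) : ℤ)

lemma card_divisorPairs_le (M : ℕ) :
    ((divisorPairs M).card : ℝ) ≤ 3 * (M * (1 + log M)) := by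
  rw [divisorPairs, Finset.card_sigma]
  push_cast
  have hterm : ∀ s ∈ Finset.Icc 1 M,
      ((Finset.Icc (-((M / s : ℕ) : ℤ)) ((M / s : ℕ) : ℤ)).card : ℝ) ≤ 3 * (M * (s : ℝ)⁻¹) := by
    intro s hs
    obtain ⟨hs1, hs2⟩ := Finset.mem_Icc.1 hs
    have h1 : (1 : ℕ) ≤ M / s := (Nat.one_le_div_iff hs1).2 hs2
    have h2 : (Finset.Icc (-((M / s : ℕ) : ℤ)) ((M / s : ℕ) : ℤ)).card = 2 * (M / s) + 1 := by
      rw [Int.card_Icc]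
      omega
    have h3 : ((M / s : ℕ) : ℝ) ≤ M * (s : ℝ)⁻¹ := Nat.cast_div_le
    have h4 : (1 : ℝ) ≤ ((M / s : ℕ) : ℝ) := by exact_mod_cast h1
    rw [h2]
    push_cast
    linarith
  refine (Finset.sum_le_sum hterm).trans ?_
  rw [← Finset.mul_sum, ← Finset.mul_sum]
  gcongr
  have h := harmonic_le_one_add_log M
  rw [harmonic_eq_sum_Icc] at h
  push_cast at h
  exact h

lemma mem_divisorPairs {M s : ℕ} {A : ℤ} (hs : 1 ≤ s) (hA : A ≠ 0) (h : s * A.natAbs ≤ M) :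
    (⟨s, A⟩ : Σ _ : ℕ, ℤ) ∈ divisorPairs M := by
  have hA' : 1 ≤ A.natAbs := Int.natAbs_pos.2 hA
  rw [divisorPairs, Finset.mem_sigma, Finset.mem_Icc, Finset.mem_Icc]
  have h1 : A.natAbs ≤ M / s := (Nat.le_div_iff_mul_le hs).2 (by rwa [mul_comm])
  refine ⟨⟨hs, by nlinarith⟩, ?_, ?_⟩ <;> simp only <;> omega

/-- A form with non-zero leading coefficient which is reducible has a rational linear factor. -/
lemma exists_coprime_root {f : BinaryCubic} (hf : f.1 ≠ 0) (h : ¬ IrredForm f) :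
    ∃ r s : ℤ, 0 < s ∧ IsCoprime r s ∧ evalForm f r s = 0 := by
  rw [irredForm_iff] at h
  push Not at h
  obtain ⟨r, s, hrs, hne⟩ := h
  have hs : s ≠ 0 := by
    rintro rfl
    have h0 : f.1 * r ^ 3 = 0 := by
      simpa [evalForm] using hrs
    have hr : r = 0 := by
      rcases mul_eq_zero.1 h0 with h | h
      · exact absurd h hf
      · exact pow_eq_zero_iff (by norm_num) |>.1 h
    exact hne hr rfl
  obtain ⟨r', s', hg, hr, hs'⟩ := Int.exists_gcd_one (Int.gcd_pos_of_ne_zero_right r hs)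
  set g : ℤ := (Int.gcd r s : ℤ) with hgdef
  have hg0 : g ≠ 0 := by
    have := Int.gcd_pos_of_ne_zero_right r hs
    rw [hgdef]
    exact_mod_cast this.ne'
  have hroot : evalForm f r' s' = 0 := by
    have : g ^ 3 * evalForm f r' s' = 0 := by
      rw [← hrs, hr, hs']
      simp only [evalForm]
      ring
    exact (mul_eq_zero.1 this).resolve_left (pow_ne_zero 3 hg0)
  have hcop : IsCoprime r' s' := Int.isCoprime_iff_gcd_eq_one.2 hg
  have hs0 : s' ≠ 0 := by
    rintro rfl
    exact hs (by simpa using hs')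
  rcases lt_or_gt_of_ne hs0 with h | h
  · refine ⟨-r', -s', by linarith, hcop.neg_neg, ?_⟩
    have : evalForm f (-r') (-s') = -evalForm f r' s' := by
      simp only [evalForm]
      ring
    rw [this, hroot, neg_zero]
  · exact ⟨r', s', h, hcop, hroot⟩

/-- Recover a form from a divisor of the leading coefficient, a divisor of the last coefficient,
a sign and the second coefficient, given that it has the corresponding rational root. -/
def formOfRoot (x : (Σ _ : ℕ, ℤ) × (Σ _ : ℕ, ℤ) × ℤ × ℤ) : BinaryCubic :=
  ((x.1.1 : ℤ) * x.1.2, x.2.2.2,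
    (x.2.1.2 * (x.1.1 : ℤ) ^ 2 - x.1.2 * (x.2.2.1 * x.2.1.1) ^ 2 -
      x.2.2.2 * (x.2.2.1 * x.2.1.1)) / (x.1.1 : ℤ), -(x.2.2.1 * x.2.1.1 * x.2.1.2))

lemma exists_formOfRoot {M : ℕ} {f : BinaryCubic} (hf : f.1 ≠ 0) (hd : f.2.2.2 ≠ 0)
    (h : ¬ IrredForm f) (h1 : f.1.natAbs ≤ M) (h2 : f.2.1.natAbs ≤ M)
    (h4 : f.2.2.2.natAbs ≤ M) :
    ∃ x ∈ divisorPairs M ×ˢ divisorPairs M ×ˢ ({1, -1} : Finset ℤ) ×ˢ Finset.Icc (-(M : ℤ)) M,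
      formOfRoot x = f := by
  obtain ⟨r, s, hs, hcop, hroot⟩ := exists_coprime_root hf h
  obtain ⟨a, b, c, d⟩ := f
  simp only [evalForm] at hroot hf hd h1 h2 h4
  have hsa : s ∣ a := by
    refine (hcop.symm.pow_right (n := 3)).dvd_of_dvd_mul_right ⟨-(b * r ^ 2 + c * r * s + d * s ^ 2), ?_⟩
    linarith
  have hrd : r ∣ d := by
    refine (hcop.pow_right (n := 3)).dvd_of_dvd_mul_right ⟨-(a * r ^ 2 + b * r * s + c * s ^ 2), ?_⟩
    linarith
  obtain ⟨A, rfl⟩ := hsa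
  obtain ⟨C, rfl⟩ := hrd
  have hr0 : r ≠ 0 := left_ne_zero_of_mul hd
  have hkey : c * s = -C * s ^ 2 - A * r ^ 2 - b * r := by
    have : r * s * (c * s - (-C * s ^ 2 - A * r ^ 2 - b * r)) = 0 := by linarith
    rcases mul_eq_zero.1 this with h | h
    · exact absurd h (mul_ne_zero hr0 hs.ne')
    · linarith
  lift s to ℕ using hs.le
  have hs1 : 1 ≤ s := by exact_mod_cast hs
  have hsgn : r.sign * r.natAbs = r := Int.sign_mul_natAbs r
  refine ⟨(⟨s, A⟩, ⟨r.natAbs, -C⟩, r.sign, b), ?_, ?_⟩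
  · simp only [Finset.mem_product, Finset.mem_insert, Finset.mem_singleton, Finset.mem_Icc]
    refine ⟨mem_divisorPairs hs1 (right_ne_zero_of_mul hf) ?_,
      mem_divisorPairs (Int.natAbs_pos.2 hr0) (neg_ne_zero.2 (right_ne_zero_of_mul hd)) ?_, ?_,
      by omega⟩
    · rwa [Int.natAbs_mul, Int.natAbs_natCast] at h1
    · rwa [Int.natAbs_neg, ← Int.natAbs_mul]
    · rcases lt_or_gt_of_ne hr0 with h | h
      · right
        exact Int.sign_eq_neg_one_of_neg h
      · left
        exact Int.sign_eq_one_of_pos h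
  · simp only [formOfRoot, hsgn, Prod.mk.injEq, true_and]
    refine ⟨?_, by ring⟩
    exact Int.ediv_eq_of_eq_mul_left hs.ne' hkey.symm

/-- Reducible forms with non-zero leading coefficient and bounded coefficients. -/
def reducibleForms (B : ℝ) : Set BinaryCubic :=
  {f | f.1 ≠ 0 ∧ ¬ IrredForm f ∧ f ∈ formBox B B B B}

lemma ncard_reducibleForms_le {B : ℝ} (hB : 1 ≤ B) :
    ((reducibleForms B).ncard : ℝ) ≤ B ^ 3 * (27 + 54 * (1 + log B) ^ 2) := by
  classical
  set M := ⌊B⌋₊ with hM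
  have hM1 : 1 ≤ M := (Nat.one_le_floor_iff B).2 hB
  have hMB : (M : ℝ) ≤ B := Nat.floor_le (by linarith)
  have hM1' : (1 : ℝ) ≤ M := by exact_mod_cast hM1
  have habs : ∀ {n : ℤ}, |(n : ℝ)| ≤ B → n.natAbs ≤ M := by
    intro n hn
    rw [hM, Nat.le_floor_iff (by linarith), Nat.cast_natAbs]
    exact_mod_cast hn
  set I := Finset.Icc (-(M : ℤ)) M with hI
  have hIcard : (I.card : ℝ) ≤ 3 * M := by
    have : I.card = 2 * M + 1 := by
      rw [hI, Int.card_Icc]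
      omega
    rw [this]
    push_cast
    linarith
  set T := divisorPairs M ×ˢ divisorPairs M ×ˢ ({1, -1} : Finset ℤ) ×ˢ I with hT
  have hsub : reducibleForms B ⊆
      (((I ×ˢ I ×ˢ I ×ˢ {0}) ∪ T.image formOfRoot : Finset BinaryCubic) : Set BinaryCubic) := by
    rintro f ⟨h1, h2, h3⟩
    rw [mem_formBox] at h3
    obtain ⟨ha, hb, hc, hd⟩ := h3
    rw [Finset.coe_union]
    by_cases h0 : f.2.2.2 = 0
    · left
      have := habs ha
      have := habs hb
      have := habs hc
      simp only [Finset.mem_coe, Finset.mem_product, Finset.mem_singleton, hI, Finset.mem_Icc]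
      refine ⟨?_, ?_, ?_, h0⟩ <;> omega
    · right
      obtain ⟨x, hx, rfl⟩ := exists_formOfRoot h1 h0 h2 (habs ha) (habs hb) (habs hd)
      exact Finset.mem_coe.2 (Finset.mem_image_of_mem _ hx)
  have hle := Set.ncard_le_ncard hsub (Finset.finite_toSet _)
  rw [Set.ncard_coe_finset] at hle
  have hle2 := (hle.trans (Finset.card_union_le _ _)).trans
    (add_le_add_right (Finset.card_image_le (s := T) (f := formOfRoot)) _)
  rw [hT] at hle2
  simp only [Finset.card_product, Finset.card_singleton] at hle2
  have hle3 : ((reducibleForms B).ncard : ℝ) ≤ I.card * (I.card * (I.card * 1)) +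
      (divisorPairs M).card * ((divisorPairs M).card * (2 * I.card)) := by
    exact_mod_cast hle2
  have hQ : ((divisorPairs M).card : ℝ) ≤ 3 * (B * (1 + log B)) := by
    refine (card_divisorPairs_le M).trans ?_
    have := log_nonneg hM1'
    gcongr
  have hI' : (I.card : ℝ) ≤ 3 * B := hIcard.trans (by linarith)
  have hlog := log_nonneg hB
  calc ((reducibleForms B).ncard : ℝ) ≤ _ := hle3
    _ ≤ 3 * B * (3 * B * (3 * B * 1)) + 3 * (B * (1 + log B)) * (3 * (B * (1 + log B)) *
        (2 * (3 * B))) := by gcongr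
    _ = _ := by ring

lemma tendsto_ncard_reducibleForms {B : ℝ} (hB : 0 < B) :
    Tendsto (fun t : ℝ => ((reducibleForms (B * t)).ncard : ℝ) / t ^ 4) atTop (nhds 0) := by
  have hlim : ∀ n : ℕ, Tendsto (fun x : ℝ => log x ^ n / x) atTop (nhds 0) := fun n =>
    (isLittleO_pow_log_id_atTop (n := n)).tendsto_div_nhds_zero
  have h1 : Tendsto (fun x : ℝ => B ^ 4 * (81 * (log x ^ 0 / x) + 108 * (log x ^ 1 / x) +
      54 * (log x ^ 2 / x))) atTop (nhds (B ^ 4 * (81 * 0 + 108 * 0 + 54 * 0))) :=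
    ((((hlim 0).const_mul 81).add ((hlim 1).const_mul 108)).add
      ((hlim 2).const_mul 54)).const_mul _
  have h2 := h1.comp (tendsto_id.const_mul_atTop hB)
  simp only [mul_zero, add_zero] at h2
  refine squeeze_zero' (Eventually.of_forall fun t => by positivity) ?_ h2
  filter_upwards [eventually_ge_atTop (1 / B), eventually_gt_atTop 0] with t ht ht0
  have hBt : 1 ≤ B * t := by
    rw [div_le_iff₀ hB] at ht
    linarith
  rw [div_le_iff₀ (by positivity)]
  refine (ncard_reducibleForms_le hBt).trans_eq ?_
  simp only [Function.comp_apply, id]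
  field_simp
  ring

lemma finite_and_countClasses_le {P : BinaryCubic → Prop} {F : Set BinaryCubic} (hF : F.Finite)
    (hP : ∀ f, P f → ∃ g ∈ F, P g ∧ FormEquiv f g) :
    Finite (Quot fun f g : { f : BinaryCubic // P f } => FormEquiv f.1 g.1) ∧
      countClasses P ≤ F.ncard := by
  have hfin : (F ∩ {f | P f}).Finite := hF.subset Set.inter_subset_left
  have : Finite ↥(F ∩ {f | P f}) := hfin
  let φ : ↥(F ∩ {f | P f}) → Quot fun f g : { f : BinaryCubic // P f } => FormEquiv f.1 g.1 :=
    fun f => Quot.mk _ ⟨f.1, f.2.2⟩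
  have hφ : Function.Surjective φ := by
    rintro ⟨f, hf⟩
    obtain ⟨g, hg, hPg, h⟩ := hP f hf
    exact ⟨⟨g, hg, hPg⟩, Quot.sound (r := fun f g : { f : BinaryCubic // P f } =>
      FormEquiv f.1 g.1) (formEquiv_symm h)⟩
  refine ⟨Finite.of_surjective φ hφ, (Nat.card_le_card_of_surjective φ hφ).trans ?_⟩
  rw [Nat.card_coe_set_eq]
  exact Set.ncard_le_ncard Set.inter_subset_left hF

/-- The equivalence class of a form satisfying `P`. -/
def formClass {P : BinaryCubic → Prop} (f : { f : BinaryCubic // P f }) :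
    Quot fun f g : { f : BinaryCubic // P f } => FormEquiv f.1 g.1 :=
  Quot.mk _ f

lemma formClass_eq {P : BinaryCubic → Prop} {f g : { f : BinaryCubic // P f }}
    (h : formClass f = formClass g) : FormEquiv f.1 g.1 := by
  have heq : Equivalence fun f g : { f : BinaryCubic // P f } => FormEquiv f.1 g.1 :=
    ⟨fun f => formEquiv_refl f.1, fun h => formEquiv_symm h, fun h h' => formEquiv_trans h h'⟩
  exact heq.eqvGen_iff.1 (Quot.eqvGen_exact h)

lemma ncard_le_countClasses {P : BinaryCubic → Prop} {F : Set BinaryCubic}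
    (hfin : Finite (Quot fun f g : { f : BinaryCubic // P f } => FormEquiv f.1 g.1))
    (hF : ∀ f ∈ F, P f) (hinj : ∀ f ∈ F, ∀ g ∈ F, FormEquiv f g → f = g) :
    F.ncard ≤ countClasses P := by
  rw [← Nat.card_coe_set_eq]
  refine Nat.card_le_card_of_injective (fun f : F => formClass (P := P) ⟨f.1, hF f.1 f.2⟩) ?_
  rintro ⟨f, hf⟩ ⟨g, hg⟩ h
  have hfg : FormEquiv f g := formClass_eq (P := P) (f := ⟨f, hF f hf⟩) (g := ⟨g, hF g hg⟩) h
  exact Subtype.ext (hinj f hf g hg hfg)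

/-- Forms in a congruence class whose rescaled coefficient vector lies in a region. -/
def formsIn (m : ℕ) (Sbar : Set (ZMod m × ZMod m × ZMod m × ZMod m)) (s : Set (Fin 4 → ℝ))
    (t : ℝ) : Set BinaryCubic :=
  {f | redMod m f ∈ Sbar ∧ t⁻¹ • coeffVec f ∈ s}

/-- The irreducible forms in a congruence class with discriminant of the sign of `e` and of
absolute value less than `X`. -/
def IsCounted (m : ℕ) (Sbar : Set (ZMod m × ZMod m × ZMod m × ZMod m)) (e X : ℝ)
    (f : BinaryCubic) : Prop :=
  redMod m f ∈ Sbar ∧ IrredForm f ∧ 0 < e * (discF f : ℝ) ∧ e * (discF f : ℝ) < X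

lemma smul_coeffVec {e t u v p q : ℝ} {f : BinaryCubic}
    (h : HasParam e p q u v f) : t⁻¹ • coeffVec f = cubicMap e ![u, v, p / t, q / t] := by
  rw [hasParam_iff_coeffVec.1 h, ← cubicMap_smul, div_eq_inv_mul, div_eq_inv_mul]

lemma exists_hasParam_of_mem {e t V : ℝ} {f : BinaryCubic} (ht : 0 < t)
    (h : t⁻¹ • coeffVec f ∈ cubicMap e '' innerDomain e V) :
    ∃ p q u v, HasParam e p q u v f ∧ 0 < p ∧ 0 < v ∧ 0 < u ∧ u < 1 / 2 ∧ 1 < u ^ 2 + v ^ 2 ∧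
      (56 + 52 * e) * v ^ 6 * (p ^ 2 + q ^ 2) ^ 2 < t ^ 4 := by
  obtain ⟨w, ⟨h1, h2, h3, h4, h5, h6, h7⟩, hw⟩ := h
  refine ⟨t * w 2, t * w 3, w 0, w 1, ?_, by positivity, h3, h1, h2, h5, ?_⟩
  · rw [hasParam_iff_coeffVec, cubicMap_smul]
    have hvec : ![w 0, w 1, w 2, w 3] = w := by
      ext i
      fin_cases i <;> rfl
    rw [hvec, hw, smul_inv_smul₀ ht.ne']
  · have := mul_lt_mul_of_pos_left h7 (pow_pos ht 4)
    nlinarith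

lemma countClasses_upper {m : ℕ} {Sbar : Set (ZMod m × ZMod m × ZMod m × ZMod m)}
    (hinv : ∀ f g : BinaryCubic, FormEquiv f g → (redMod m f ∈ Sbar ↔ redMod m g ∈ Sbar))
    {e t V : ℝ} (he : e = 1 ∨ e = -1) (ht : 0 < t) (hV : 1 ≤ V) :
    Finite (Quot fun f g : { f : BinaryCubic // IsCounted m Sbar e (t ^ 4) f } =>
        FormEquiv f.1 g.1) ∧
      (countClasses (IsCounted m Sbar e (t ^ 4)) : ℝ) ≤
        (formsIn m Sbar (cubicMap e '' outerDomain e V) t).ncard + 2125764 * t ^ 4 / V := by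
  obtain ⟨hfin, hcard⟩ := cuspForms_tail he ht hV
  have hfin' : (formsIn m Sbar (cubicMap e '' outerDomain e V) t).Finite :=
    (finite_coeffVec_mem (isBounded_image he V).2 ht).subset fun f hf => hf.2
  have hκ : 4 ≤ 56 + 52 * e := by rcases he with rfl | rfl <;> norm_num
  have key := finite_and_countClasses_le (P := IsCounted m Sbar e (t ^ 4)) (hfin'.union hfin) ?_
  · refine ⟨key.1, ?_⟩
    have := key.2.trans (Set.ncard_union_le _ _)
    have : (countClasses (IsCounted m Sbar e (t ^ 4)) : ℝ) ≤
        (formsIn m Sbar (cubicMap e '' outerDomain e V) t).ncard +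
          (cuspForms e t (Set.Ici V)).ncard := by exact_mod_cast this
    linarith
  · rintro f ⟨hS, hirr, hd, hX⟩
    obtain ⟨g, hfg, p, q, u, v, hpar, hp, hv, hu0, hu1, hz⟩ := exists_reduced he hirr hd
    have hdisc := disc_param he hpar
    rw [discF_of_formEquiv hfg] at hdisc
    have hSg := (hinv f g hfg).1 hS
    refine ⟨g, ?_, ⟨hSg, irredForm_of_formEquiv hfg hirr, ?_, ?_⟩, hfg⟩
    · rcases le_total v V with hvV | hvV
      · left
        refine ⟨hSg, ?_⟩
        rw [smul_coeffVec hpar]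
        refine Set.mem_image_of_mem _ ⟨hu0, hu1, hv.le, hvV, hz, ?_, ?_⟩
        · exact div_nonneg hp.le ht.le
        · have : (56 + 52 * e) * (v ^ 6 * ((p / t) ^ 2 + (q / t) ^ 2) ^ 2) =
              e * (discF f : ℝ) / t ^ 4 := by
            rw [hdisc]
            field_simp
          refine this.trans_le ((div_le_one (by positivity)).2 hX.le)
      · right
        refine ⟨?_, p, q, u, v, hpar, hu0, hu1, hvV, ?_⟩
        · have : (0 : ℝ) < g.1 := by rw [hpar.1]; exact hp
          have : (0 : ℤ) < g.1 := by exact_mod_cast this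
          omega
        · have h0 : 0 ≤ v ^ 6 * (p ^ 2 + q ^ 2) ^ 2 := by positivity
          nlinarith
    · rwa [discF_of_formEquiv hfg]
    · rwa [discF_of_formEquiv hfg]

lemma countClasses_lower {m : ℕ} {Sbar : Set (ZMod m × ZMod m × ZMod m × ZMod m)}
    {e V : ℝ} (he : e = 1 ∨ e = -1) :
    ∃ B : ℝ, 0 < B ∧ ∀ t : ℝ, 0 < t →
      Finite (Quot fun f g : { f : BinaryCubic // IsCounted m Sbar e (t ^ 4) f } =>
        FormEquiv f.1 g.1) →
      ((formsIn m Sbar (cubicMap e '' innerDomain e V) t).ncard : ℝ) ≤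
        countClasses (IsCounted m Sbar e (t ^ 4)) + (reducibleForms (B * t)).ncard := by
  obtain ⟨B, hB, hbound⟩ := (isBounded_image he V).1.exists_pos_norm_le
  refine ⟨B, hB, fun t ht hfin => ?_⟩
  have hκ : 0 < 56 + 52 * e := by rcases he with rfl | rfl <;> norm_num
  set A := formsIn m Sbar (cubicMap e '' innerDomain e V) t with hA
  have hAfin : A.Finite :=
    (finite_coeffVec_mem (isBounded_image he V).1 ht).subset fun f hf => hf.2
  have hRfin : (reducibleForms (B * t)).Finite :=
    (Finset.finite_toSet (formBox (B * t) (B * t) (B * t) (B * t))).subset fun f hf => hf.2.2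
  have hle : A.ncard ≤ {f ∈ A | IrredForm f}.ncard + (reducibleForms (B * t)).ncard := by
    refine (Set.ncard_le_ncard ?_ ((hAfin.subset (Set.sep_subset _ _)).union hRfin)).trans
      (Set.ncard_union_le _ _)
    intro f hf
    by_cases hirr : IrredForm f
    · exact Or.inl ⟨hf, hirr⟩
    · right
      obtain ⟨p, q, u, v, hpar, hp, -⟩ := exists_hasParam_of_mem ht hf.2
      refine ⟨?_, hirr, ?_⟩
      · have : (f.1 : ℝ) ≠ 0 := by rw [hpar.1]; exact hp.ne'
        exact_mod_cast this
      · have hn := hbound _ hf.2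
        rw [norm_smul, norm_inv, norm_of_nonneg ht.le, inv_mul_le_iff₀ ht, mul_comm t] at hn
        have hi := fun i => (norm_le_pi_norm (coeffVec f) i).trans hn
        exact mem_formBox.2 ⟨hi 0, hi 1, hi 2, hi 3⟩
  have hle2 : {f ∈ A | IrredForm f}.ncard ≤ countClasses (IsCounted m Sbar e (t ^ 4)) := by
    refine ncard_le_countClasses hfin ?_ ?_
    · rintro f ⟨hf, hirr⟩
      obtain ⟨p, q, u, v, hpar, hp, hv, -, -, -, h⟩ := exists_hasParam_of_mem ht hf.2
      rw [← disc_param he hpar] at h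
      refine ⟨hf.1, hirr, ?_, h⟩
      rw [disc_param he hpar]
      positivity
    · rintro f ⟨hf, -⟩ g ⟨hg, -⟩ hfg
      obtain ⟨p, q, u, v, hpar, hp, hv, hu0, hu1, hz, -⟩ := exists_hasParam_of_mem ht hf.2
      obtain ⟨p', q', u', v', hpar', hp', hv', hu0', hu1', hz', -⟩ :=
        exists_hasParam_of_mem ht hg.2
      exact eq_of_reduced he hfg hpar hpar' hp hp' hv hv' hu0 hu1 hu0' hu1' hz hz'
  exact_mod_cast hle.trans (by omega)

lemma tendsto_countClasses_pow_four {m : ℕ} (hm : 1 ≤ m)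
    {Sbar : Set (ZMod m × ZMod m × ZMod m × ZMod m)}
    (hinv : ∀ f g : BinaryCubic, FormEquiv f g → (redMod m f ∈ Sbar ↔ redMod m g ∈ Sbar))
    {e : ℝ} (he : e = 1 ∨ e = -1) :
    Tendsto (fun t : ℝ => (countClasses (IsCounted m Sbar e (t ^ 4)) : ℝ) / t ^ 4) atTop
      (nhds ((Nat.card Sbar : ℝ) / (m : ℝ) ^ 4 *
        ((20 + 16 * e) * π / (4 * (56 + 52 * e)) * (π / 6)))) := by
  set D := (Nat.card Sbar : ℝ) / (m : ℝ) ^ 4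
  set K := (20 + 16 * e) * π / (4 * (56 + 52 * e))
  have hinvV : Tendsto (fun V : ℝ => V⁻¹) atTop (nhds 0) := tendsto_inv_atTop_zero
  have hlow : Tendsto (fun V : ℝ => D * (K * (π / 6 - 1 / (2 * V)))) atTop
      (nhds (D * (K * (π / 6)))) := by
    have := (((hinvV.const_mul (1 / 2)).const_sub (π / 6)).const_mul K).const_mul D
    simp only [mul_zero, sub_zero] at this
    refine this.congr fun V => ?_
    ring
  have hup : Tendsto (fun V : ℝ => D * (K * (π / 6 - 1 / (2 * V))) + 2125764 / V) atTop
      (nhds (D * (K * (π / 6)))) := by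
    have := hlow.add (hinvV.const_mul 2125764)
    simpa only [mul_zero, add_zero, div_eq_mul_inv] using this
  rw [tendsto_order]
  constructor
  · intro a ha
    obtain ⟨V, hVa, hV⟩ := ((hlow.eventually_const_lt ha).and (eventually_ge_atTop 1)).exists
    obtain ⟨B, hB, hbound⟩ := countClasses_lower (m := m) (Sbar := Sbar) (V := V) he
    have h1 := tendsto_ncard_forms hm Sbar (isBounded_image he V).1 (measurableSet_image he V).1
      (frontier_image_null he V).1
    rw [(volume_real_image he hV).1] at h1
    have h2 := h1.sub (tendsto_ncard_reducibleForms hB)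
    rw [sub_zero] at h2
    filter_upwards [h2.eventually_const_lt hVa, eventually_gt_atTop 0] with t h ht
    refine h.trans_le ?_
    rw [← sub_div]
    gcongr
    rw [sub_le_iff_le_add]
    exact hbound t ht (countClasses_upper hinv he ht hV).1
  · intro b hb
    obtain ⟨V, hVb, hV⟩ := ((hup.eventually_lt_const hb).and (eventually_ge_atTop 1)).exists
    have h1 := tendsto_ncard_forms hm Sbar (isBounded_image he V).2 (measurableSet_image he V).2
      (frontier_image_null he V).2
    rw [(volume_real_image he hV).2] at h1
    filter_upwards [(h1.add_const (2125764 / V)).eventually_lt_const hVb,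
      eventually_gt_atTop 0] with t h ht
    refine lt_of_le_of_lt ?_ h
    rw [div_le_iff₀ (by positivity), add_mul, div_mul_cancel₀ _ (by positivity), div_mul_eq_mul_div]
    exact (countClasses_upper hinv he ht hV).2

lemma tendsto_countClasses {m : ℕ} (hm : 1 ≤ m)
    {Sbar : Set (ZMod m × ZMod m × ZMod m × ZMod m)}
    (hinv : ∀ f g : BinaryCubic, FormEquiv f g → (redMod m f ∈ Sbar ↔ redMod m g ∈ Sbar))
    {e : ℝ} (he : e = 1 ∨ e = -1) :
    Tendsto (fun X : ℝ => (countClasses (IsCounted m Sbar e X) : ℝ) / X) atTop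
      (nhds ((20 + 16 * e) * π / (4 * (56 + 52 * e)) * (π / 6) *
        ((Nat.card Sbar : ℝ) / (m : ℝ) ^ 4))) := by
  rw [mul_comm]
  refine ((tendsto_countClasses_pow_four hm hinv he).comp
    (tendsto_rpow_atTop (y := 1 / 4) (by norm_num))).congr' ?_
  filter_upwards [eventually_ge_atTop 0] with X hX
  have : (X ^ (1 / 4 : ℝ)) ^ 4 = X := by
    rw [← rpow_natCast, ← rpow_mul hX]
    norm_num
  simp only [Function.comp_apply, this]

theorem congruence_main_term (m : ℕ) (hm : 1 ≤ m)
    (Sbar : Set (ZMod m × ZMod m × ZMod m × ZMod m))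
    (hinv : ∀ f g : BinaryCubic, FormEquiv f g → (redMod m f ∈ Sbar ↔ redMod m g ∈ Sbar)) :
    Tendsto
      (fun X : ℝ =>
        ((countClasses fun f =>
            redMod m f ∈ Sbar ∧ IrredForm f ∧ 0 < (discF f : ℝ) ∧ (discF f : ℝ) < X) : ℝ) / X)
      atTop (nhds (π ^ 2 / (12 * 6) * ((Nat.card Sbar : ℝ) / (m : ℝ) ^ 4))) ∧
    Tendsto
      (fun X : ℝ =>
        ((countClasses fun f =>
            redMod m f ∈ Sbar ∧ IrredForm f ∧ -X < (discF f : ℝ) ∧ (discF f : ℝ) < 0) : ℝ) / X)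
      atTop (nhds (π ^ 2 / (12 * 2) * ((Nat.card Sbar : ℝ) / (m : ℝ) ^ 4))) := by
  constructor
  · have h := tendsto_countClasses hm hinv (e := 1) (Or.inl rfl)
    rw [show (20 + 16 * 1) * π / (4 * (56 + 52 * 1)) * (π / 6) = π ^ 2 / (12 * 6) by ring] at h
    refine h.congr fun X => ?_
    congr 3
    funext f
    simp only [IsCounted, one_mul]
  · have h := tendsto_countClasses hm hinv (e := -1) (Or.inr rfl)
    rw [show (20 + 16 * -1) * π / (4 * (56 + 52 * -1)) * (π / 6) = π ^ 2 / (12 * 2) by ring] at h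
    refine h.congr fun X => ?_
    congr 3
    funext f
    simp only [IsCounted, neg_mul, one_mul, Left.neg_pos_iff, neg_lt, and_comm]
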